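/- arXiv:2203.16086 — 4 statements merged into one kernel-verified Lean document; each statement's English description precedes it below -/
import Mathlib

section
/- There is an absolute constant C > 0 such that for all real x ≥ 3 and all integers b ≥ 1, J ≥ 1 and ℓ ≥ 0: (1/|M|) · Σ_{m ∈ M} Σ_{k | m} (log k)^ℓ / k ≥ (e^γ/(ℓ+1)) · (1 − C(1/J + J·(log log x)/b + J²/(log x))) · (log x)^{ℓ+1}. -/
open Finset Real

/-- `P x b = ∏_{p ≤ x} p^(b-1)`, product over primes `p ≤ x`. -/
noncomputable def resonatorProd (x : ℝ) (b : ℕ) : ℕ :=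
  ∏ p ∈ (Finset.range (⌊x⌋₊ + 1)).filter Nat.Prime, p ^ (b - 1)

/-- The weight `-log (1 - 1/n)` on primes, extended by zero. -/
noncomputable def primeWeight (n : ℕ) : ℝ :=
  if n.Prime then -Real.log (1 - 1 / (n : ℝ)) else 0

theorem inv_le_neg_log_one_sub {p : ℕ} (hp : p.Prime) :
    1 / (p : ℝ) ≤ -Real.log (1 - 1 / (p : ℝ)) := by
  have h2 : (2 : ℝ) ≤ p := by exact_mod_cast hp.two_le
  have : (1 : ℝ) / p ≤ 1 / 2 := one_div_le_one_div_of_le (by norm_num) h2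
  have := Real.log_le_sub_one_of_pos (x := 1 - 1 / (p : ℝ)) (by linarith)
  linarith

theorem neg_log_one_sub_le {p : ℕ} (hp : p.Prime) :
    -Real.log (1 - 1 / (p : ℝ)) ≤ 1 / ((p : ℝ) - 1) := by
  have h2 : (2 : ℝ) ≤ p := by exact_mod_cast hp.two_le
  have h1 : (1 : ℝ) / p ≤ 1 / 2 := one_div_le_one_div_of_le (by norm_num) h2
  have := Real.one_sub_inv_le_log_of_pos (x := 1 - 1 / (p : ℝ)) (by linarith)
  have h3 : (1 - 1 / (p : ℝ))⁻¹ = 1 + 1 / ((p : ℝ) - 1) := by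
    have : (p : ℝ) - 1 ≠ 0 := by linarith
    have : (p : ℝ) ≠ 0 := by linarith
    rw [one_sub_div this, inv_div]
    field_simp
    ring
  rw [h3] at this
  linarith

theorem primeWeight_nonneg (n : ℕ) : 0 ≤ primeWeight n := by
  unfold primeWeight
  split_ifs with h
  · exact le_trans (by positivity) (inv_le_neg_log_one_sub h)
  · exact le_rfl

theorem log_factorial_eq_sum_primesLE (N : ℕ) :
    Real.log (N.factorial : ℝ) =
      ∑ p ∈ N.primesLE, (N.factorial.factorization p : ℝ) * Real.log p := by
  rw [Real.log_nat_eq_sum_factorization, Finsupp.sum]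
  apply Finset.sum_subset
  · intro p hp
    have hp' := Nat.support_factorization _ ▸ hp
    have h1 := Nat.prime_of_mem_primeFactors hp'
    exact Nat.mem_primesLE.2 ⟨(h1.dvd_factorial).1 (Nat.dvd_of_mem_primeFactors hp'), h1⟩
  · intro p _ hp
    rw [Finsupp.notMem_support_iff.1 hp]
    simp

theorem sum_log_div_primesLE_le {N : ℕ} (hN : 1 ≤ N) :
    ∑ p ∈ N.primesLE, Real.log p / p ≤ Real.log N + Real.log 4 := by
  have hN0 : (0 : ℝ) < N := by exact_mod_cast hN
  have h1 : Real.log (N.factorial : ℝ) ≤ N * Real.log N := by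
    rw [← Real.log_pow]
    apply Real.log_le_log (by exact_mod_cast N.factorial_pos)
    exact_mod_cast Nat.factorial_le_pow N
  have h2 : ∑ p ∈ N.primesLE, ((N : ℝ) / p - 1) * Real.log p ≤ Real.log (N.factorial : ℝ) := by
    rw [log_factorial_eq_sum_primesLE]
    apply Finset.sum_le_sum
    intro p hp
    have hpp := Nat.prime_of_mem_primesLE hp
    apply mul_le_mul_of_nonneg_right _ (Real.log_natCast_nonneg p)
    have h3 : N / p ≤ N.factorial.factorization p := by
      rw [Nat.factorization_factorial hpp (Nat.lt_add_of_pos_right (n := Nat.log p N) (k := 2) (by norm_num))]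
      calc N / p = N / p ^ 1 := by rw [pow_one]
        _ ≤ _ := Finset.single_le_sum (f := fun i => N / p ^ i) (fun _ _ => Nat.zero_le _)
          (by simp)
    have h4 := Nat.lt_div_mul_add (a := N) hpp.pos
    have hp0 : (0 : ℝ) < p := by exact_mod_cast hpp.pos
    have h5 : (N : ℝ) < ((N / p : ℕ) : ℝ) * p + p := by exact_mod_cast h4
    have h6 : ((N / p : ℕ) : ℝ) ≤ N.factorial.factorization p := by exact_mod_cast h3
    refine le_trans ?_ h6
    rw [sub_le_iff_le_add, div_le_iff₀ hp0]
    linarith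
  have h3 := Chebyshev.theta_le_log4_mul_x hN0.le
  rw [Chebyshev.theta_eq_sum_primesLE_log] at h3
  have h4 : ∑ p ∈ N.primesLE, ((N : ℝ) / p - 1) * Real.log p =
      N * ∑ p ∈ N.primesLE, Real.log p / p - ∑ p ∈ N.primesLE, Real.log p := by
    rw [Finset.mul_sum, ← Finset.sum_sub_distrib]
    apply Finset.sum_congr rfl
    intros; ring
  have h5 : (N : ℝ) * ∑ p ∈ N.primesLE, Real.log p / p ≤ N * (Real.log N + Real.log 4) := by
    linarith
  exact le_of_mul_le_mul_left h5 hN0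

theorem le_sum_log_div_pred_primesLE {N : ℕ} (hN : 1 ≤ N) :
    Real.log N - 1 ≤ ∑ p ∈ N.primesLE, Real.log p / ((p : ℝ) - 1) := by
  have hN0 : (0 : ℝ) < N := by exact_mod_cast hN
  have h1 := Stirling.le_log_factorial_stirling (n := N) (by omega)
  have h2 : Real.log (N.factorial : ℝ) ≤ N * ∑ p ∈ N.primesLE, Real.log p / ((p : ℝ) - 1) := by
    rw [log_factorial_eq_sum_primesLE, Finset.mul_sum]
    apply Finset.sum_le_sum
    intro p hp
    have hpp := Nat.prime_of_mem_primesLE hp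
    have h3 := Nat.factorization_factorial_le_div_pred hpp N
    have h4 : (N.factorial.factorization p : ℝ) ≤ N / ((p : ℝ) - 1) := by
      calc (N.factorial.factorization p : ℝ) ≤ ((N / (p - 1) : ℕ) : ℝ) := by exact_mod_cast h3
        _ ≤ (N : ℝ) / ((p - 1 : ℕ) : ℝ) := Nat.cast_div_le
        _ = _ := by rw [Nat.cast_sub hpp.one_lt.le]; simp
    calc _ ≤ N / ((p : ℝ) - 1) * Real.log p :=
          mul_le_mul_of_nonneg_right h4 (Real.log_natCast_nonneg p)
      _ = _ := by ring
  have h5 : 0 ≤ Real.log N := Real.log_natCast_nonneg N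
  have h6 : 0 ≤ Real.log (2 * π) := Real.log_nonneg (by linarith [Real.pi_gt_three])
  have h7 : (N : ℝ) * (Real.log N - 1) ≤ N * ∑ p ∈ N.primesLE, Real.log p / ((p : ℝ) - 1) := by
    linarith
  exact le_of_mul_le_mul_left h7 hN0

theorem exists_sum_log_div_mul_pred_le :
    ∃ E : ℝ, 0 ≤ E ∧ ∀ N : ℕ, ∑ p ∈ N.primesLE, Real.log p / ((p : ℝ) * (p - 1)) ≤ E := by
  have hs : Summable fun n : ℕ => 4 * (1 / (n : ℝ) ^ (3 / 2 : ℝ)) :=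
    (Real.summable_one_div_nat_rpow.2 (by norm_num)).mul_left 4
  refine ⟨∑' n : ℕ, 4 * (1 / (n : ℝ) ^ (3 / 2 : ℝ)), tsum_nonneg fun n => by positivity, ?_⟩
  intro N
  refine le_trans (Finset.sum_le_sum ?_) (hs.sum_le_tsum N.primesLE fun n _ => by positivity)
  intro p hp
  have h2 : (2 : ℝ) ≤ p := by exact_mod_cast Nat.two_le_of_mem_primesLE hp
  have hp0 : (0 : ℝ) < p := by linarith
  have hl : Real.log p ≤ 2 * (p : ℝ) ^ (1 / 2 : ℝ) := by
    have := Real.log_le_rpow_div hp0.le (ε := 1 / 2) (by norm_num)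
    linarith
  have h3 : (p : ℝ) ^ (2 : ℝ) = p ^ (1 / 2 : ℝ) * p ^ (3 / 2 : ℝ) := by
    rw [← Real.rpow_add hp0]; norm_num
  have h4 : (p : ℝ) ^ (2 : ℝ) = p ^ 2 := Real.rpow_two _
  have h5 : (0 : ℝ) < (p : ℝ) ^ (3 / 2 : ℝ) := by positivity
  rw [mul_one_div, div_le_div_iff₀ (by nlinarith) h5]
  calc Real.log p * (p : ℝ) ^ (3 / 2 : ℝ) ≤ 2 * p ^ (1 / 2 : ℝ) * p ^ (3 / 2 : ℝ) := by gcongr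
    _ = 2 * p ^ 2 := by rw [mul_assoc, ← h3, h4]
    _ ≤ 4 * (p * (p - 1)) := by nlinarith

/-- A form of Mertens' first theorem. -/
theorem exists_abs_sum_primeWeight_mul_log_sub_log_le :
    ∃ K : ℝ, 0 ≤ K ∧ ∀ N : ℕ, 1 ≤ N →
      |∑ n ∈ range (N + 1), primeWeight n * Real.log n - Real.log N| ≤ K := by
  obtain ⟨E, hE0, hE⟩ := exists_sum_log_div_mul_pred_le
  refine ⟨E + 2, by linarith, fun N hN => ?_⟩
  have h0 : ∑ n ∈ range (N + 1), primeWeight n * Real.log n =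
      ∑ p ∈ N.primesLE, -Real.log (1 - 1 / (p : ℝ)) * Real.log p := by
    rw [Nat.primesLE_eq_filter_range, Finset.sum_filter]
    apply Finset.sum_congr rfl
    intro n _
    unfold primeWeight
    split_ifs <;> simp
  have hsplit : ∑ p ∈ N.primesLE, Real.log p / ((p : ℝ) - 1) =
      ∑ p ∈ N.primesLE, Real.log p / p + ∑ p ∈ N.primesLE, Real.log p / ((p : ℝ) * (p - 1)) := by
    rw [← Finset.sum_add_distrib]
    apply Finset.sum_congr rfl
    intro p hp
    have h2 : (2 : ℝ) ≤ p := by exact_mod_cast Nat.two_le_of_mem_primesLE hp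
    have h3 : (p : ℝ) - 1 ≠ 0 := by linarith
    field_simp
    ring
  have hlow : ∑ p ∈ N.primesLE, Real.log p / p ≤
      ∑ p ∈ N.primesLE, -Real.log (1 - 1 / (p : ℝ)) * Real.log p := by
    apply Finset.sum_le_sum
    intro p hp
    have := mul_le_mul_of_nonneg_right (inv_le_neg_log_one_sub (Nat.prime_of_mem_primesLE hp))
      (Real.log_natCast_nonneg p)
    calc Real.log p / p = 1 / (p : ℝ) * Real.log p := by ring
      _ ≤ _ := this
  have hup : ∑ p ∈ N.primesLE, -Real.log (1 - 1 / (p : ℝ)) * Real.log p ≤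
      ∑ p ∈ N.primesLE, Real.log p / ((p : ℝ) - 1) := by
    apply Finset.sum_le_sum
    intro p hp
    have := mul_le_mul_of_nonneg_right (neg_log_one_sub_le (Nat.prime_of_mem_primesLE hp))
      (Real.log_natCast_nonneg p)
    calc _ ≤ 1 / ((p : ℝ) - 1) * Real.log p := this
      _ = _ := by ring
  have h1 := sum_log_div_primesLE_le hN
  have h2 := le_sum_log_div_pred_primesLE hN
  have h3 := hE N
  have h4 : Real.log 4 ≤ 2 := by
    rw [show (4 : ℝ) = 2 ^ 2 by norm_num, Real.log_pow]
    have := Real.log_two_lt_d9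
    push_cast
    linarith
  rw [h0, abs_le]
  constructor <;> linarith

theorem abs_log_sub_log_sub_div_le {a b : ℝ} (ha : 0 < a) (hab : a ≤ b) (h1 : b - a ≤ 1) :
    |(b - a) / b - (Real.log b - Real.log a)| ≤ 1 / a - 1 / b := by
  have hb : 0 < b := ha.trans_le hab
  have hlog : Real.log b - Real.log a = Real.log (b / a) := (Real.log_div hb.ne' ha.ne').symm
  have hu := Real.log_le_sub_one_of_pos (div_pos hb ha)
  have hl := Real.one_sub_inv_le_log_of_pos (div_pos hb ha)
  have e1 : b / a - 1 = (b - a) / b + (b - a) * (1 / a - 1 / b) := by field_simp; ring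
  have e2 : 1 - (b / a)⁻¹ = (b - a) / b := by field_simp
  have h2 : 0 ≤ 1 / a - 1 / b := sub_nonneg.2 (one_div_le_one_div_of_le ha hab)
  have h3 : (b - a) * (1 / a - 1 / b) ≤ 1 * (1 / a - 1 / b) :=
    mul_le_mul_of_nonneg_right h1 h2
  rw [hlog, abs_le]
  constructor <;> linarith

/-- Partial sums of `primeWeight` satisfy a Cauchy-type form of Mertens' second theorem. -/
theorem exists_abs_sum_primeWeight_sub_le :
    ∃ K : ℝ, 0 ≤ K ∧ ∀ M N : ℕ, 2 ≤ M → M ≤ N →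
      |(∑ n ∈ range (N + 1), primeWeight n - Real.log (Real.log N)) -
        (∑ n ∈ range (M + 1), primeWeight n - Real.log (Real.log M))| ≤ K / Real.log M := by
  obtain ⟨K, hK0, hK⟩ := exists_abs_sum_primeWeight_mul_log_sub_log_le
  refine ⟨3 * K + 1, by linarith, fun M N hM hMN => ?_⟩
  set S : ℕ → ℝ := fun N => ∑ n ∈ range (N + 1), primeWeight n * Real.log n - Real.log N with hS
  set F : ℕ → ℝ := fun N => ∑ n ∈ range (N + 1), primeWeight n - Real.log (Real.log N) -
    S N / Real.log N with hF
  have hlogpos : ∀ n : ℕ, 2 ≤ n → 0 < Real.log n := fun n hn =>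
    Real.log_pos (by exact_mod_cast hn)
  have key : |F N - F M| ≤ (K + 1) * (1 / Real.log M - 1 / Real.log N) := by
    induction N, hMN using Nat.le_induction with
    | base => simp
    | succ n hn ih =>
      have hn2 : 2 ≤ n := hM.trans hn
      have hl := hlogpos n hn2
      have hl' := hlogpos (n + 1) (by omega)
      have hn0 : (0 : ℝ) < n := by exact_mod_cast (by omega : 0 < n)
      have hle : Real.log n ≤ Real.log ((n + 1 : ℕ) : ℝ) :=
        Real.log_le_log hn0 (by push_cast; linarith)
      have hdiff : Real.log ((n + 1 : ℕ) : ℝ) - Real.log n ≤ 1 := by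
        rw [← Real.log_div (by positivity) hn0.ne']
        have h1 := Real.log_le_sub_one_of_pos (x := ((n + 1 : ℕ) : ℝ) / n) (by positivity)
        have h2 : ((n + 1 : ℕ) : ℝ) / n - 1 = 1 / n := by push_cast; field_simp; ring
        have h3 : (1 : ℝ) / n ≤ 1 := by
          rw [div_le_one hn0]; exact_mod_cast (by omega : 1 ≤ n)
        linarith
      have hA := abs_log_sub_log_sub_div_le hl hle hdiff
      have hSn : |S n| ≤ K := hK n (by omega)
      have hstep : F (n + 1) - F n =
          ((Real.log ((n + 1 : ℕ) : ℝ) - Real.log n) / Real.log ((n + 1 : ℕ) : ℝ) -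
            (Real.log (Real.log ((n + 1 : ℕ) : ℝ)) - Real.log (Real.log n))) +
          S n * (1 / Real.log n - 1 / Real.log ((n + 1 : ℕ) : ℝ)) := by
        simp only [hF, hS]
        rw [Finset.sum_range_succ _ (n + 1), Finset.sum_range_succ _ (n + 1)]
        field_simp
        ring
      have hnn : 0 ≤ 1 / Real.log n - 1 / Real.log ((n + 1 : ℕ) : ℝ) :=
        (abs_nonneg _).trans hA
      have hB : |S n * (1 / Real.log n - 1 / Real.log ((n + 1 : ℕ) : ℝ))| ≤
          K * (1 / Real.log n - 1 / Real.log ((n + 1 : ℕ) : ℝ)) := by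
        rw [abs_mul, abs_of_nonneg hnn]
        exact mul_le_mul_of_nonneg_right hSn hnn
      have hC : |F (n + 1) - F n| ≤
          (K + 1) * (1 / Real.log n - 1 / Real.log ((n + 1 : ℕ) : ℝ)) := by
        rw [hstep]
        refine (abs_add_le _ _).trans ?_
        linarith
      calc |F (n + 1) - F M| = |(F (n + 1) - F n) + (F n - F M)| := by ring_nf
        _ ≤ _ := abs_add_le _ _
        _ ≤ _ := by linarith
  have hlM := hlogpos M hM
  have hlN := hlogpos N (hM.trans hMN)
  have hMN' : Real.log M ≤ Real.log N :=
    Real.log_le_log (by exact_mod_cast (by omega : 0 < M)) (by exact_mod_cast hMN)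
  have hinv : 1 / Real.log N ≤ 1 / Real.log M := one_div_le_one_div_of_le hlM hMN'
  have hN0 : 0 < 1 / Real.log N := by positivity
  have b1 : |S N / Real.log N| ≤ K * (1 / Real.log M) := by
    rw [abs_div, abs_of_pos hlN, div_eq_mul_one_div]
    exact mul_le_mul (hK N (by omega)) hinv hN0.le hK0
  have b2 : |S M / Real.log M| ≤ K * (1 / Real.log M) := by
    rw [abs_div, abs_of_pos hlM, div_eq_mul_one_div]
    exact mul_le_mul_of_nonneg_right (hK M (by omega)) (by positivity)
  have e : (∑ n ∈ range (N + 1), primeWeight n - Real.log (Real.log N)) -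
      (∑ n ∈ range (M + 1), primeWeight n - Real.log (Real.log M)) =
      (F N - F M) + (S N / Real.log N - S M / Real.log M) := by
    simp only [hF]; ring
  rw [e]
  refine (abs_add_le _ _).trans ?_
  have b3 := abs_sub (S N / Real.log N) (S M / Real.log M)
  have b4 : (K + 1) * (1 / Real.log M - 1 / Real.log N) ≤ (K + 1) * (1 / Real.log M) :=
    mul_le_mul_of_nonneg_left (by linarith) (by linarith)
  rw [div_eq_mul_one_div (3 * K + 1)]
  linarith

theorem exists_abs_sum_primeWeight_sub_log_log_sub_le :
    ∃ L K : ℝ, 0 ≤ K ∧ ∀ N : ℕ, 2 ≤ N →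
      |∑ n ∈ range (N + 1), primeWeight n - Real.log (Real.log N) - L| ≤ K / Real.log N := by
  obtain ⟨K, hK0, hK⟩ := exists_abs_sum_primeWeight_sub_le
  set D : ℕ → ℝ := fun N => ∑ n ∈ range (N + 1), primeWeight n - Real.log (Real.log N) with hD
  have hlog : Filter.Tendsto (fun N : ℕ => Real.log ((N + 2 : ℕ) : ℝ)) Filter.atTop
      Filter.atTop :=
    Real.tendsto_log_atTop.comp
      (tendsto_natCast_atTop_atTop.comp (Filter.tendsto_add_atTop_nat 2))
  have hc : CauchySeq fun n => D (n + 2) := by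
    apply cauchySeq_of_le_tendsto_0 (fun N => 2 * (K / Real.log ((N + 2 : ℕ) : ℝ)))
    · intro n m N hn hm
      rw [Real.dist_eq]
      have h1 := hK (N + 2) (n + 2) (by omega) (by omega)
      have h2 := hK (N + 2) (m + 2) (by omega) (by omega)
      have h3 : D (n + 2) - D (m + 2) =
        (D (n + 2) - D (N + 2)) - (D (m + 2) - D (N + 2)) := by ring
      rw [h3]
      refine (abs_sub _ _).trans ?_
      simp only [hD] at h1 h2 ⊢
      linarith
    · have := (hlog.const_div_atTop K).const_mul 2
      simpa using this
  obtain ⟨L, hL⟩ := cauchySeq_tendsto_of_complete hc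
  refine ⟨L, K, hK0, fun N hN => ?_⟩
  have hL' : Filter.Tendsto D Filter.atTop (nhds L) :=
    (Filter.tendsto_add_atTop_iff_nat 2).1 hL
  have h1 : Filter.Tendsto (fun n => |D n - D N|) Filter.atTop (nhds |L - D N|) :=
    (hL'.sub_const _).abs
  have h2 : |L - D N| ≤ K / Real.log N := by
    apply le_of_tendsto h1
    filter_upwards [Filter.eventually_ge_atTop N] with n hn
    exact hK N n hN hn
  rw [abs_sub_comm] at h2
  exact h2

theorem inv_one_sub_rpow_le_exp_primeWeight {p : ℕ} (hp : p.Prime) {s : ℝ} (hs : 1 < s) :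
    (1 - (p : ℝ) ^ (-s))⁻¹ ≤ Real.exp (primeWeight p * (p : ℝ) ^ (-(s - 1))) := by
  have h2 : (2 : ℝ) ≤ p := by exact_mod_cast hp.two_le
  have hp0 : (0 : ℝ) < p := by linarith
  have h1 : (1 : ℝ) / p ≤ 1 / 2 := one_div_le_one_div_of_le (by norm_num) h2
  have hc0 : 0 < (p : ℝ) ^ (-(s - 1)) := by positivity
  have hc1 : (p : ℝ) ^ (-(s - 1)) ≤ 1 :=
    Real.rpow_le_one_of_one_le_of_nonpos (by linarith) (by linarith)
  have hb := rpow_one_add_le_one_add_mul_self (s := -(1 / (p : ℝ))) (by linarith) hc0.le hc1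
  have he : 1 + (p : ℝ) ^ (-(s - 1)) * -(1 / (p : ℝ)) = 1 - (p : ℝ) ^ (-s) := by
    have : (p : ℝ) ^ (-s) = (p : ℝ) ^ (-(s - 1)) * (1 / (p : ℝ)) := by
      rw [one_div, ← Real.rpow_neg_one (p : ℝ), ← Real.rpow_add hp0]
      congr 1; ring
    rw [this]; ring
  rw [he, ← sub_eq_add_neg, Real.rpow_def_of_pos (by linarith)] at hb
  have hw : primeWeight p * (p : ℝ) ^ (-(s - 1)) =
      -(Real.log (1 - 1 / (p : ℝ)) * (p : ℝ) ^ (-(s - 1))) := by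
    rw [primeWeight, if_pos hp]; ring
  rw [hw, Real.exp_neg]
  exact inv_anti₀ (Real.exp_pos _) hb

/-- The total `primeWeight` of the integers in `(e ^ m, e ^ (m + 1)]`. -/
noncomputable def primeWeightBlock (m : ℕ) : ℝ :=
  ∑ n ∈ Ioc ⌊Real.exp m⌋₊ ⌊Real.exp ((m + 1 : ℕ) : ℝ)⌋₊, primeWeight n

theorem floor_exp_le_floor_exp_succ (m : ℕ) :
    ⌊Real.exp m⌋₊ ≤ ⌊Real.exp ((m + 1 : ℕ) : ℝ)⌋₊ :=
  Nat.floor_mono (Real.exp_le_exp.2 (by push_cast; linarith))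

theorem sum_range_floor_exp_succ (f : ℕ → ℝ) (m : ℕ) :
    ∑ n ∈ range (⌊Real.exp ((m + 1 : ℕ) : ℝ)⌋₊ + 1), f n =
      ∑ n ∈ range (⌊Real.exp m⌋₊ + 1), f n +
        ∑ n ∈ Ioc ⌊Real.exp m⌋₊ ⌊Real.exp ((m + 1 : ℕ) : ℝ)⌋₊, f n := by
  rw [← Finset.sum_range_add_sum_Ico f (Nat.succ_le_succ (floor_exp_le_floor_exp_succ m))]
  congr 1
  apply Finset.sum_congr _ fun _ _ => rfl
  ext n
  simp only [Finset.mem_Ico, Finset.mem_Ioc]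
  omega

theorem primeWeight_zero : primeWeight 0 = 0 := by simp [primeWeight, Nat.not_prime_zero]

theorem primeWeight_one : primeWeight 1 = 0 := by simp [primeWeight, Nat.not_prime_one]

theorem sum_primeWeightBlock (k : ℕ) :
    ∑ m ∈ range k, primeWeightBlock m =
      ∑ n ∈ range (⌊Real.exp k⌋₊ + 1), primeWeight n := by
  induction k with
  | zero => simp [Finset.sum_range_succ, primeWeight_zero, primeWeight_one]
  | succ k ih => rw [Finset.sum_range_succ, ih, sum_range_floor_exp_succ, primeWeightBlock]

theorem sum_primeWeight_mul_rpow_le {s : ℝ} (hs : 1 < s) (k : ℕ) :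
    ∑ n ∈ range (⌊Real.exp k⌋₊ + 1), primeWeight n * (n : ℝ) ^ (-(s - 1)) ≤
      ∑ m ∈ range k, primeWeightBlock m * Real.exp (-(s - 1)) ^ m := by
  induction k with
  | zero => simp [Finset.sum_range_succ, primeWeight_zero, primeWeight_one]
  | succ k ih =>
    rw [Finset.sum_range_succ _ k, sum_range_floor_exp_succ]
    refine add_le_add ih ?_
    rw [primeWeightBlock, Finset.sum_mul]
    apply Finset.sum_le_sum
    intro n hn
    apply mul_le_mul_of_nonneg_left _ (primeWeight_nonneg n)
    have h1 : Real.exp k < n := Nat.lt_of_floor_lt (Finset.mem_Ioc.1 hn).1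
    calc (n : ℝ) ^ (-(s - 1)) ≤ (Real.exp k) ^ (-(s - 1)) :=
          Real.rpow_le_rpow_of_nonpos (Real.exp_pos _) h1.le (by linarith)
      _ = Real.exp (-(s - 1)) ^ k := by
          rw [← Real.exp_mul, ← Real.exp_nat_mul]

theorem tsum_rpow_le_exp_tsum_primeWeightBlock {s : ℝ} (hs : 1 < s)
    (hsum : Summable fun m => primeWeightBlock m * Real.exp (-(s - 1)) ^ m) :
    ∑' n : ℕ, 1 / (n : ℝ) ^ s ≤
      Real.exp (∑' m, primeWeightBlock m * Real.exp (-(s - 1)) ^ m) := by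
  let f : ℕ →*₀ ℝ :=
    { toFun := fun n => (n : ℝ) ^ (-s)
      map_zero' := by simp [Real.zero_rpow (by linarith : -s ≠ 0)]
      map_one' := by simp
      map_mul' := fun m n => by
        push_cast
        rw [Real.mul_rpow (Nat.cast_nonneg _) (Nat.cast_nonneg _)] }
  have hfs : ∀ n : ℕ, 1 / (n : ℝ) ^ s = f n := fun n => by
    change _ = (n : ℝ) ^ (-s)
    rw [Real.rpow_neg (Nat.cast_nonneg _), one_div]
  have hsf : Summable fun n => ‖f n‖ := by
    have := Real.summable_one_div_nat_rpow.2 hs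
    simp_rw [hfs] at this
    exact this.norm
  have hnn : ∀ m, 0 ≤ primeWeightBlock m := fun m =>
    Finset.sum_nonneg fun n _ => primeWeight_nonneg n
  have ht := EulerProduct.eulerProduct_completely_multiplicative hsf
  have hidx : Filter.Tendsto (fun k : ℕ => ⌊Real.exp k⌋₊ + 1) Filter.atTop Filter.atTop :=
    (Filter.tendsto_add_atTop_nat 1).comp (tendsto_nat_floor_atTop.comp
      (Real.tendsto_exp_atTop.comp tendsto_natCast_atTop_atTop))
  simp_rw [hfs]
  refine le_of_tendsto (ht.comp hidx) (Filter.Eventually.of_forall fun k => ?_)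
  have h1 : ∏ p ∈ (⌊Real.exp k⌋₊ + 1).primesBelow, (1 - f p)⁻¹ ≤
      Real.exp (∑ n ∈ range (⌊Real.exp k⌋₊ + 1), primeWeight n * (n : ℝ) ^ (-(s - 1))) := by
    have e : ∑ n ∈ range (⌊Real.exp k⌋₊ + 1), primeWeight n * (n : ℝ) ^ (-(s - 1)) =
        ∑ p ∈ (⌊Real.exp k⌋₊ + 1).primesBelow, primeWeight p * (p : ℝ) ^ (-(s - 1)) := by
      rw [Nat.primesBelow, Finset.sum_filter]
      apply Finset.sum_congr rfl
      intro n _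
      by_cases h : n.Prime <;> simp [primeWeight, h]
    rw [e, Real.exp_sum]
    apply Finset.prod_le_prod
    · intro p hp
      have hpp := Nat.prime_of_mem_primesBelow hp
      have : f p ≤ 1 := Real.rpow_le_one_of_one_le_of_nonpos
        (by exact_mod_cast hpp.one_lt.le) (by linarith)
      exact inv_nonneg.2 (by linarith)
    · intro p hp
      exact inv_one_sub_rpow_le_exp_primeWeight (Nat.prime_of_mem_primesBelow hp) hs
  refine h1.trans (Real.exp_le_exp.2 ((sum_primeWeight_mul_rpow_le hs k).trans ?_))
  exact hsum.sum_le_tsum _ fun m _ => mul_nonneg (hnn m) (by positivity)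

theorem tendsto_log_log_floor_exp_sub_log :
    Filter.Tendsto (fun k : ℕ => Real.log (Real.log (⌊Real.exp k⌋₊ : ℝ)) - Real.log k)
      Filter.atTop (nhds 0) := by
  have h1 : Filter.Tendsto (fun k : ℕ => Real.log (⌊Real.exp k⌋₊ : ℝ) / k)
      Filter.atTop (nhds 1) := by
    have hlow : Filter.Tendsto (fun k : ℕ => 1 - 1 / (k : ℝ)) Filter.atTop (nhds 1) := by
      simpa using (tendsto_one_div_atTop_nhds_zero_nat (𝕜 := ℝ)).const_sub 1
    refine tendsto_of_tendsto_of_tendsto_of_le_of_le' hlow tendsto_const_nhds ?_ ?_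
    · filter_upwards [Filter.eventually_ge_atTop 1] with k hk
      have hk0 : (0 : ℝ) < k := by exact_mod_cast hk
      have hk1 : (1 : ℝ) ≤ k := by exact_mod_cast hk
      have hf := Nat.lt_floor_add_one (Real.exp k)
      have he : Real.exp k = Real.exp 1 * Real.exp ((k : ℝ) - 1) := by
        rw [← Real.exp_add]; ring_nf
      have he1 : 2 ≤ Real.exp 1 := by linarith [Real.add_one_le_exp (1 : ℝ)]
      have he2 : 1 ≤ Real.exp ((k : ℝ) - 1) := Real.one_le_exp (by linarith)
      have h3 : Real.exp ((k : ℝ) - 1) ≤ ⌊Real.exp k⌋₊ := by nlinarith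
      have h4 : (k : ℝ) - 1 ≤ Real.log ⌊Real.exp k⌋₊ :=
        (Real.le_log_iff_exp_le (lt_of_lt_of_le (Real.exp_pos _) h3)).2 h3
      rw [le_div_iff₀ hk0, sub_mul, one_div, inv_mul_cancel₀ hk0.ne']
      linarith
    · filter_upwards [Filter.eventually_ge_atTop 1] with k hk
      have hk0 : (0 : ℝ) < k := by exact_mod_cast hk
      have h3 : (0 : ℝ) < ⌊Real.exp k⌋₊ := by
        exact_mod_cast Nat.floor_pos.2 (Real.one_le_exp hk0.le)
      rw [div_le_one hk0, Real.log_le_iff_le_exp h3]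
      exact Nat.floor_le (Real.exp_pos _).le
  have h2 := h1.log one_ne_zero
  rw [Real.log_one] at h2
  apply h2.congr'
  have h3 : ∀ᶠ k : ℕ in Filter.atTop, 0 < Real.log (⌊Real.exp k⌋₊ : ℝ) / k :=
    h1.eventually (lt_mem_nhds one_pos)
  filter_upwards [h3, Filter.eventually_ge_atTop 1] with k hk hk1
  have hk0 : (0 : ℝ) < k := by exact_mod_cast hk1
  rw [Real.log_div (by rintro h; simp [h] at hk) hk0.ne']

theorem sum_range_inv_eq_harmonic (k : ℕ) :
    ∑ m ∈ range (k + 1), ((m : ℝ))⁻¹ = harmonic k := by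
  rw [Finset.sum_range_succ', harmonic]
  push_cast
  simp

/-- The constant in Mertens' third theorem is at least `γ`. -/
theorem eulerMascheroniConstant_le_of_tendsto {L : ℝ}
    (hL : Filter.Tendsto
      (fun N : ℕ => ∑ n ∈ range (N + 1), primeWeight n - Real.log (Real.log N))
      Filter.atTop (nhds L)) :
    Real.eulerMascheroniConstant ≤ L := by
  set d : ℕ → ℝ := fun m => primeWeightBlock m - ((m : ℝ))⁻¹ with hd
  have hfl : Filter.Tendsto (fun k : ℕ => ⌊Real.exp k⌋₊) Filter.atTop Filter.atTop :=
    tendsto_nat_floor_atTop.comp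
      (Real.tendsto_exp_atTop.comp tendsto_natCast_atTop_atTop)
  have hT : Filter.Tendsto (fun k : ℕ => ∑ m ∈ range k, primeWeightBlock m - Real.log k)
      Filter.atTop (nhds L) := by
    have := (hL.comp hfl).add tendsto_log_log_floor_exp_sub_log
    rw [add_zero] at this
    apply this.congr
    intro k
    simp only [Function.comp]
    rw [sum_primeWeightBlock]
    ring
  have hsumd : Filter.Tendsto (fun k : ℕ => ∑ m ∈ range k, d m) Filter.atTop
      (nhds (L - Real.eulerMascheroniConstant)) := by
    rw [← Filter.tendsto_add_atTop_iff_nat 1]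
    have := (hT.comp (Filter.tendsto_add_atTop_nat 1)).sub Real.tendsto_harmonic_sub_log_add_one
    apply this.congr
    intro k
    simp only [Function.comp, hd, Finset.sum_sub_distrib]
    rw [sum_range_inv_eq_harmonic]
    push_cast
    ring
  have hd0 : Filter.Tendsto d Filter.atTop (nhds 0) := by
    have := (hsumd.comp (Filter.tendsto_add_atTop_nat 1)).sub hsumd
    rw [sub_self] at this
    apply this.congr
    intro k
    simp [Function.comp, Finset.sum_range_succ]
  have ha0 : Filter.Tendsto primeWeightBlock Filter.atTop (nhds 0) := by
    have := hd0.add (tendsto_inv_atTop_nhds_zero_nat (𝕜 := ℝ))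
    rw [add_zero] at this
    apply this.congr
    intro k
    simp [hd]
  have habel := Real.tendsto_tsum_powerSeries_nhdsWithin_lt hsumd
  have hz : Filter.Tendsto (fun s : ℝ => Real.exp (-(s - 1))) (nhdsWithin 1 (Set.Ioi 1))
      (nhdsWithin 1 (Set.Iio 1)) := by
    apply tendsto_nhdsWithin_of_tendsto_nhds_of_eventually_within
    · have : Continuous fun s : ℝ => Real.exp (-(s - 1)) := by fun_prop
      have h := this.tendsto 1
      simp only [sub_self, neg_zero, Real.exp_zero] at h
      exact h.mono_left nhdsWithin_le_nhds
    · filter_upwards [self_mem_nhdsWithin] with s hs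
      have hs' : 1 < s := hs
      exact Real.exp_lt_one_iff.2 (by linarith)
  have hlim := (Real.continuous_exp.tendsto _).comp (habel.comp hz)
  have hleft : Filter.Tendsto (fun s : ℝ => 1 / s * ((s - 1) * ∑' n : ℕ, 1 / (n : ℝ) ^ s))
      (nhdsWithin 1 (Set.Ioi 1)) (nhds 1) := by
    have h1 : Filter.Tendsto (fun s : ℝ => 1 / s) (nhdsWithin 1 (Set.Ioi 1)) (nhds 1) := by
      have : ContinuousAt (fun s : ℝ => 1 / s) 1 :=
        continuousAt_const.div continuousAt_id one_ne_zero
      have h := this.tendsto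
      rw [one_div_one] at h
      exact h.mono_left nhdsWithin_le_nhds
    simpa using h1.mul tendsto_sub_mul_tsum_nat_rpow
  have hfin : (1 : ℝ) ≤ Real.exp (L - Real.eulerMascheroniConstant) := by
    refine le_of_tendsto_of_tendsto hleft hlim ?_
    filter_upwards [self_mem_nhdsWithin] with s hs
    have hs' : 1 < s := hs
    simp only [Function.comp]
    set z := Real.exp (-(s - 1)) with hzdef
    have hz0 : 0 < z := Real.exp_pos _
    have hz1 : z < 1 := Real.exp_lt_one_iff.2 (by linarith)
    have hgeo := summable_geometric_of_lt_one hz0.le hz1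
    have hsa : Summable fun m => primeWeightBlock m * z ^ m := by
      apply Summable.of_norm_bounded_eventually_nat hgeo
      have : ∀ᶠ m in Filter.atTop, |primeWeightBlock m| < 1 := by
        have h := ha0.abs
        rw [abs_zero] at h
        exact h.eventually (gt_mem_nhds one_pos)
      filter_upwards [this] with m hm
      rw [norm_mul, Real.norm_eq_abs, Real.norm_eq_abs, abs_of_pos (pow_pos hz0 m)]
      exact mul_le_of_le_one_left (pow_pos hz0 m).le hm.le
    have hlogs : HasSum (fun m : ℕ => ((m : ℝ))⁻¹ * z ^ m) (-Real.log (1 - z)) := by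
      have h := Real.hasSum_pow_div_log_of_abs_lt_one (x := z) (by rwa [abs_of_pos hz0])
      rw [← hasSum_nat_add_iff' 1]
      simp only [range_one, sum_singleton, Nat.cast_zero, inv_zero, zero_mul, sub_zero]
      apply h.congr_fun
      intro m
      push_cast
      field_simp
    have htd : ∑' m, d m * z ^ m = ∑' m, primeWeightBlock m * z ^ m + Real.log (1 - z) := by
      have h := (hsa.hasSum.sub hlogs).tsum_eq
      rw [sub_neg_eq_add] at h
      rw [← h]
      apply tsum_congr
      intro m
      simp only [hd]; ring
    rw [htd, Real.exp_add, Real.exp_log (by linarith)]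
    have h1 := tsum_rpow_le_exp_tsum_primeWeightBlock hs' hsa
    have h2 : 1 / s * (s - 1) ≤ 1 - z := by
      have h3 : z ≤ 1 / s := by
        rw [hzdef, Real.exp_neg, one_div]
        apply inv_anti₀ (by linarith)
        linarith [Real.add_one_le_exp (s - 1)]
      have h4 : 1 / s * (s - 1) = 1 - 1 / s := by field_simp
      linarith
    have h5 : 0 ≤ ∑' n : ℕ, 1 / (n : ℝ) ^ s := tsum_nonneg fun n => by positivity
    calc 1 / s * ((s - 1) * ∑' n : ℕ, 1 / (n : ℝ) ^ s)
        = (∑' n : ℕ, 1 / (n : ℝ) ^ s) * (1 / s * (s - 1)) := by ring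
      _ ≤ (∑' n : ℕ, 1 / (n : ℝ) ^ s) * (1 - z) := mul_le_mul_of_nonneg_left h2 h5
      _ ≤ _ := mul_le_mul_of_nonneg_right h1 (by linarith)
  have := Real.one_le_exp_iff.1 hfin
  linarith

theorem exp_sum_primeWeight (N : ℕ) :
    Real.exp (∑ n ∈ range (N + 1), primeWeight n) =
      ∏ p ∈ N.primesLE, (1 - 1 / (p : ℝ))⁻¹ := by
  have h : ∑ n ∈ range (N + 1), primeWeight n =
      ∑ p ∈ N.primesLE, -Real.log (1 - 1 / (p : ℝ)) := by
    rw [Nat.primesLE_eq_filter_range, Finset.sum_filter]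
    rfl
  rw [h, Real.exp_sum]
  apply Finset.prod_congr rfl
  intro p hp
  have h2 : (2 : ℝ) ≤ p := by exact_mod_cast Nat.two_le_of_mem_primesLE hp
  have h1 : (1 : ℝ) / p ≤ 1 / 2 := one_div_le_one_div_of_le (by norm_num) h2
  rw [Real.exp_neg, Real.exp_log (by linarith)]

theorem two_le_floor {x : ℝ} (hx : 3 ≤ x) : 2 ≤ ⌊x⌋₊ :=
  Nat.le_floor (by push_cast; linarith)

theorem log_sub_one_le_log_floor {x : ℝ} (hx : 3 ≤ x) :
    Real.log x - 1 ≤ Real.log ⌊x⌋₊ := by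
  have hf := Nat.lt_floor_add_one x
  have hN : (0 : ℝ) < ⌊x⌋₊ := by linarith
  have he : 2 ≤ Real.exp 1 := by linarith [Real.add_one_le_exp (1 : ℝ)]
  have h1 : Real.log x ≤ Real.log (Real.exp 1 * ⌊x⌋₊) :=
    Real.log_le_log (by linarith) (by nlinarith)
  rw [Real.log_mul (Real.exp_pos _).ne' hN.ne', Real.log_exp] at h1
  linarith

/-- The lower bound in Mertens' third theorem. -/
theorem exists_exp_eulerMascheroniConstant_mul_le_prod :
    ∃ K : ℝ, 0 ≤ K ∧ ∀ x : ℝ, 3 ≤ x →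
      Real.exp Real.eulerMascheroniConstant * (Real.log x - K) ≤
        ∏ p ∈ ⌊x⌋₊.primesLE, (1 - 1 / (p : ℝ))⁻¹ := by
  obtain ⟨L, K, hK0, hK⟩ := exists_abs_sum_primeWeight_sub_log_log_sub_le
  have hlogt : Filter.Tendsto (fun N : ℕ => Real.log (N : ℝ)) Filter.atTop Filter.atTop :=
    Real.tendsto_log_atTop.comp tendsto_natCast_atTop_atTop
  have hL : Filter.Tendsto
      (fun N : ℕ => ∑ n ∈ range (N + 1), primeWeight n - Real.log (Real.log N))
      Filter.atTop (nhds L) := by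
    rw [tendsto_iff_norm_sub_tendsto_zero]
    refine squeeze_zero' (Filter.Eventually.of_forall fun _ => norm_nonneg _) ?_
      (hlogt.const_div_atTop K)
    filter_upwards [Filter.eventually_ge_atTop 2] with N hN
    exact hK N hN
  have hγ := eulerMascheroniConstant_le_of_tendsto hL
  refine ⟨K + 1, by linarith, fun x hx => ?_⟩
  have hN := two_le_floor hx
  have hlog := log_sub_one_le_log_floor hx
  set N := ⌊x⌋₊
  have hl : 0 < Real.log N := Real.log_pos (by exact_mod_cast hN)
  have h1 := (abs_le.1 (hK N hN)).1
  rw [← exp_sum_primeWeight]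
  have h2 : Real.eulerMascheroniConstant + Real.log (Real.log N) + -(K / Real.log N) ≤
      ∑ n ∈ range (N + 1), primeWeight n := by linarith
  refine le_trans ?_ (Real.exp_le_exp.2 h2)
  rw [Real.exp_add, Real.exp_add, Real.exp_log hl, mul_assoc]
  apply mul_le_mul_of_nonneg_left _ (Real.exp_pos _).le
  have h3 := Real.add_one_le_exp (-(K / Real.log N))
  calc Real.log x - (K + 1) ≤ Real.log N - K := by linarith
    _ = Real.log N * (-(K / Real.log N) + 1) := by field_simp; ring
    _ ≤ _ := mul_le_mul_of_nonneg_left h3 hl.le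

theorem log_log_three_pos : 0 < Real.log (Real.log 3) := by
  apply Real.log_pos
  rw [Real.lt_log_iff_exp_lt (by norm_num)]
  linarith [Real.exp_one_lt_d9]

theorem log_log_three_le {x : ℝ} (hx : 3 ≤ x) :
    Real.log (Real.log 3) ≤ Real.log (Real.log x) :=
  Real.log_le_log (Real.log_pos (by norm_num)) (Real.log_le_log (by norm_num) hx)

theorem exists_sum_inv_pred_primesLE_le :
    ∃ K : ℝ, 0 ≤ K ∧ ∀ x : ℝ, 3 ≤ x →
      ∑ p ∈ ⌊x⌋₊.primesLE, 1 / ((p : ℝ) - 1) ≤ K * Real.log (Real.log x) := by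
  obtain ⟨L, K, hK0, hK⟩ := exists_abs_sum_primeWeight_sub_log_log_sub_le
  have h3 := log_log_three_pos
  have hl2 : 0 < Real.log 2 := Real.log_pos (by norm_num)
  set R := |L| + K / Real.log 2 with hR
  have hR0 : 0 ≤ R := by positivity
  refine ⟨2 * (1 + R / Real.log (Real.log 3)), by positivity, fun x hx => ?_⟩
  have hN := two_le_floor hx
  have hll := log_log_three_le hx
  have hNx : ((⌊x⌋₊ : ℕ) : ℝ) ≤ x := Nat.floor_le (by linarith)
  set N := ⌊x⌋₊
  have hN2 : (2 : ℝ) ≤ N := by exact_mod_cast hN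
  have hl : 0 < Real.log N := Real.log_pos (by linarith)
  have h1 := (abs_le.1 (hK N hN)).2
  have h2 : K / Real.log N ≤ K / Real.log 2 :=
    div_le_div_of_nonneg_left hK0 hl2 (Real.log_le_log (by norm_num) hN2)
  have h4 : Real.log (Real.log N) ≤ Real.log (Real.log x) :=
    Real.log_le_log hl (Real.log_le_log (by linarith) hNx)
  have h5 : ∑ p ∈ N.primesLE, 1 / ((p : ℝ) - 1) ≤ 2 * ∑ n ∈ range (N + 1), primeWeight n := by
    rw [Nat.primesLE_eq_filter_range, Finset.sum_filter, Finset.mul_sum]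
    apply Finset.sum_le_sum
    intro n _
    split_ifs with h
    · have hw := inv_le_neg_log_one_sub h
      have hn2 : (2 : ℝ) ≤ n := by exact_mod_cast h.two_le
      rw [primeWeight, if_pos h]
      have : 1 / ((n : ℝ) - 1) ≤ 2 * (1 / n) := by
        rw [mul_one_div, div_le_div_iff₀ (by linarith) (by linarith)]
        linarith
      linarith
    · have := primeWeight_nonneg n
      linarith
  have h6 : R ≤ R / Real.log (Real.log 3) * Real.log (Real.log x) := by
    rw [div_mul_eq_mul_div, le_div_iff₀ h3]
    exact mul_le_mul_of_nonneg_left hll hR0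
  have h7 := le_abs_self L
  calc _ ≤ _ := h5
    _ ≤ 2 * (Real.log (Real.log x) + R) := by linarith
    _ ≤ 2 * (Real.log (Real.log x) + R / Real.log (Real.log 3) * Real.log (Real.log x)) := by
      linarith
    _ = _ := by ring

theorem one_sub_sum_le_prod_one_sub {ι : Type*} (s : Finset ι) (f : ι → ℝ)
    (h0 : ∀ i ∈ s, 0 ≤ f i) (h1 : ∀ i ∈ s, f i ≤ 1) :
    1 - ∑ i ∈ s, f i ≤ ∏ i ∈ s, (1 - f i) := by
  classical
  induction s using Finset.induction_on with
  | empty => simp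
  | insert a s ha ih =>
    rw [Finset.sum_insert ha, Finset.prod_insert ha]
    have hs0 : ∀ i ∈ s, 0 ≤ f i := fun i hi => h0 i (Finset.mem_insert_of_mem hi)
    have hs1 : ∀ i ∈ s, f i ≤ 1 := fun i hi => h1 i (Finset.mem_insert_of_mem hi)
    have ha0 := h0 a (Finset.mem_insert_self a s)
    have ha1 := h1 a (Finset.mem_insert_self a s)
    have h2 := mul_le_mul_of_nonneg_left (ih hs0 hs1) (sub_nonneg.2 ha1)
    nlinarith [Finset.sum_nonneg hs0]

/-- The arithmetic function `n ↦ 1 / n`. -/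
noncomputable def reciprocal : ArithmeticFunction ℝ :=
  ⟨fun n => ((n : ℝ))⁻¹, by simp⟩

theorem reciprocal_apply (n : ℕ) : reciprocal n = ((n : ℝ))⁻¹ := rfl

/-- Twice-summed reciprocals: `n ↦ ∑_{m ∣ n} ∑_{k ∣ m} 1 / k`. -/
noncomputable def divisorReciprocalSum : ArithmeticFunction ℝ :=
  (ArithmeticFunction.zeta : ArithmeticFunction ℝ) *
    ((ArithmeticFunction.zeta : ArithmeticFunction ℝ) * reciprocal)

theorem divisorReciprocalSum_apply (n : ℕ) :
    divisorReciprocalSum n = ∑ m ∈ n.divisors, ∑ k ∈ m.divisors, ((k : ℝ))⁻¹ := by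
  rw [divisorReciprocalSum, ArithmeticFunction.coe_zeta_mul_apply]
  simp_rw [ArithmeticFunction.coe_zeta_mul_apply, reciprocal_apply]

theorem isMultiplicative_divisorReciprocalSum : divisorReciprocalSum.IsMultiplicative := by
  have hz : (ArithmeticFunction.zeta : ArithmeticFunction ℝ).IsMultiplicative :=
    ArithmeticFunction.isMultiplicative_zeta.natCast
  refine hz.mul (hz.mul ⟨by simp [reciprocal_apply], fun {m n} _ => ?_⟩)
  simp [reciprocal_apply, mul_comm]

theorem divisorReciprocalSum_prime_pow {p b : ℕ} (hp : p.Prime) (hb : 1 ≤ b) :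
    divisorReciprocalSum (p ^ (b - 1)) =
      ∑ j ∈ range b, ∑ i ∈ range (j + 1), (1 / (p : ℝ)) ^ i := by
  rw [divisorReciprocalSum_apply, Nat.sum_divisors_prime_pow hp, Nat.sub_add_cancel hb]
  apply Finset.sum_congr rfl
  intro j _
  rw [Nat.sum_divisors_prime_pow hp]
  simp

theorem le_divisorReciprocalSum_prime_pow_div {p b : ℕ} (hp : p.Prime) (hb : 1 ≤ b) :
    (1 - 1 / (p : ℝ))⁻¹ * (1 - 1 / ((p : ℝ) - 1) / b) ≤
      divisorReciprocalSum (p ^ (b - 1)) / b := by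
  have h2 : (2 : ℝ) ≤ p := by exact_mod_cast hp.two_le
  have hb0 : (0 : ℝ) < b := by exact_mod_cast hb
  rw [divisorReciprocalSum_prime_pow hp hb]
  have hqp : 1 / ((p : ℝ) - 1) = 1 / (p : ℝ) * (1 - 1 / (p : ℝ))⁻¹ := by
    have : (p : ℝ) - 1 ≠ 0 := by linarith
    have : (p : ℝ) ≠ 0 := by linarith
    rw [one_sub_div this, inv_div]
    field_simp
  rw [hqp]
  have hq1 : (1 : ℝ) / p ≤ 1 / 2 := one_div_le_one_div_of_le (by norm_num) h2
  have hq0 : (0 : ℝ) < 1 / p := by positivity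
  set q : ℝ := 1 / (p : ℝ)
  have hq : 0 < 1 - q := by linarith
  have hgeo : ∀ n : ℕ, ∑ i ∈ range n, q ^ i = (1 - q)⁻¹ * (1 - q ^ n) := fun n => by
    rw [← mul_neg_geom_sum, inv_mul_cancel_left₀ hq.ne']
  have hsum : ∑ j ∈ range b, ∑ i ∈ range (j + 1), q ^ i =
      (1 - q)⁻¹ * (b - q * ((1 - q)⁻¹ * (1 - q ^ b))) := by
    simp_rw [hgeo]
    rw [← Finset.mul_sum, Finset.sum_sub_distrib, ← hgeo b, Finset.mul_sum]
    simp [pow_succ, mul_comm]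
  rw [hsum, mul_div_assoc _ (_ - _) (b : ℝ)]
  apply mul_le_mul_of_nonneg_left _ (inv_pos.2 hq).le
  rw [sub_div, div_self hb0.ne']
  apply sub_le_sub_left
  apply div_le_div_of_nonneg_right _ hb0.le
  apply mul_le_mul_of_nonneg_left _ hq0.le
  apply mul_le_of_le_one_right (inv_pos.2 hq).le
  linarith [pow_pos hq0 b]

theorem card_divisors_resonatorProd {x : ℝ} {b : ℕ} (hb : 1 ≤ b) :
    (resonatorProd x b).divisors.card = ∏ _p ∈ ⌊x⌋₊.primesLE, b := by
  have h := (ArithmeticFunction.isMultiplicative_sigma (k := 0)).map_prod (fun p => p ^ (b - 1))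
    ⌊x⌋₊.primesLE fun p hp q hq hpq =>
      Nat.coprime_pow_primes _ _ (Nat.prime_of_mem_primesLE hp) (Nat.prime_of_mem_primesLE hq) hpq
  rw [ArithmeticFunction.sigma_zero_apply] at h
  rw [resonatorProd, ← Nat.primesLE_eq_filter_range, h]
  apply Finset.prod_congr rfl
  intro p hp
  rw [ArithmeticFunction.sigma_zero_apply_prime_pow (Nat.prime_of_mem_primesLE hp),
    Nat.sub_add_cancel hb]

theorem prod_mul_one_sub_le_average {x : ℝ} {b : ℕ} (hb : 1 ≤ b) :
    (∏ p ∈ ⌊x⌋₊.primesLE, (1 - 1 / (p : ℝ))⁻¹) *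
        (1 - (∑ p ∈ ⌊x⌋₊.primesLE, 1 / ((p : ℝ) - 1)) / b) ≤
      1 / ((resonatorProd x b).divisors.card : ℝ) *
        ∑ m ∈ (resonatorProd x b).divisors, ∑ k ∈ m.divisors, ((k : ℝ))⁻¹ := by
  have hb0 : (1 : ℝ) ≤ b := by exact_mod_cast hb
  have h := isMultiplicative_divisorReciprocalSum.map_prod (fun p => p ^ (b - 1))
    ⌊x⌋₊.primesLE fun p hp q hq hpq =>
      Nat.coprime_pow_primes _ _ (Nat.prime_of_mem_primesLE hp) (Nat.prime_of_mem_primesLE hq) hpq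
  rw [← divisorReciprocalSum_apply, card_divisors_resonatorProd hb, resonatorProd,
    ← Nat.primesLE_eq_filter_range, h, one_div_mul_eq_div]
  push_cast
  rw [← Finset.prod_div_distrib]
  have hfac : ∀ p ∈ ⌊x⌋₊.primesLE, 0 < (1 - 1 / (p : ℝ))⁻¹ ∧ 0 ≤ 1 / ((p : ℝ) - 1) / b ∧
      1 / ((p : ℝ) - 1) / b ≤ 1 := by
    intro p hp
    have h2 : (2 : ℝ) ≤ p := by exact_mod_cast Nat.two_le_of_mem_primesLE hp
    have h1 : (1 : ℝ) / p ≤ 1 / 2 := one_div_le_one_div_of_le (by norm_num) h2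
    have h3 : 0 ≤ 1 / ((p : ℝ) - 1) := one_div_nonneg.2 (by linarith)
    have h4 : 1 / ((p : ℝ) - 1) ≤ 1 := by
      rw [div_le_one (by linarith)]; linarith
    refine ⟨inv_pos.2 (by linarith), by positivity, ?_⟩
    rw [div_le_one (by linarith)]
    linarith
  calc _ ≤ (∏ p ∈ ⌊x⌋₊.primesLE, (1 - 1 / (p : ℝ))⁻¹) *
        ∏ p ∈ ⌊x⌋₊.primesLE, (1 - 1 / ((p : ℝ) - 1) / b) := by
        apply mul_le_mul_of_nonneg_left _ (Finset.prod_nonneg fun p hp => (hfac p hp).1.le)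
        rw [Finset.sum_div]
        exact one_sub_sum_le_prod_one_sub _ _ (fun p hp => (hfac p hp).2.1)
          fun p hp => (hfac p hp).2.2
    _ = ∏ p ∈ ⌊x⌋₊.primesLE, ((1 - 1 / (p : ℝ))⁻¹ * (1 - 1 / ((p : ℝ) - 1) / b)) :=
        Finset.prod_mul_distrib.symm
    _ ≤ _ := Finset.prod_le_prod
        (fun p hp => mul_nonneg (hfac p hp).1.le (sub_nonneg.2 (hfac p hp).2.2))
        fun p hp => le_divisorReciprocalSum_prime_pow_div (Nat.prime_of_mem_primesLE hp) hb

/-- The average of `∑_{k ∣ m} 1 / k` over the divisors `m` of `resonatorProd x b`. -/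
theorem exists_exp_eulerMascheroniConstant_mul_log_mul_le_average :
    ∃ K : ℝ, 0 ≤ K ∧ ∀ x : ℝ, 3 ≤ x → ∀ b : ℕ, 1 ≤ b →
      Real.exp Real.eulerMascheroniConstant * Real.log x *
          (1 - K * (Real.log (Real.log x) / b + 1 / Real.log x)) ≤
        1 / ((resonatorProd x b).divisors.card : ℝ) *
          ∑ m ∈ (resonatorProd x b).divisors, ∑ k ∈ m.divisors, ((k : ℝ))⁻¹ := by
  obtain ⟨K₁, hK₁, h₁⟩ := exists_exp_eulerMascheroniConstant_mul_le_prod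
  obtain ⟨K₂, hK₂, h₂⟩ := exists_sum_inv_pred_primesLE_le
  refine ⟨K₁ + K₂, by linarith, fun x hx b hb => ?_⟩
  have hb0 : (0 : ℝ) < b := by exact_mod_cast hb
  have hL : 0 < Real.log x := Real.log_pos (by linarith)
  have hLL : 0 ≤ Real.log (Real.log x) := log_log_three_pos.le.trans (log_log_three_le hx)
  have hprod := prod_mul_one_sub_le_average (x := x) hb
  have h1 := h₁ x hx
  have h2 := h₂ x hx
  have hγ := Real.exp_pos Real.eulerMascheroniConstant
  set Q := ∏ p ∈ ⌊x⌋₊.primesLE, (1 - 1 / (p : ℝ))⁻¹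
  set S := ∑ p ∈ ⌊x⌋₊.primesLE, 1 / ((p : ℝ) - 1)
  set u := Real.log (Real.log x) / b with hu
  set v := 1 / Real.log x with hv
  have hu0 : 0 ≤ u := by positivity
  have hv0 : 0 ≤ v := by positivity
  by_cases hneg : 1 - (K₁ + K₂) * (u + v) ≤ 0
  · refine le_trans (mul_nonpos_of_nonneg_of_nonpos (by positivity) hneg) ?_
    positivity
  push Not at hneg
  have a1 : 0 ≤ K₁ * u := by positivity
  have a2 : 0 ≤ K₁ * v := by positivity
  have a3 : 0 ≤ K₂ * u := by positivity
  have a4 : 0 ≤ K₂ * v := by positivity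
  have hS : S / b ≤ K₂ * u := by
    rw [hu, ← mul_div_assoc]
    exact div_le_div_of_nonneg_right h2 hb0.le
  have hLv : Real.log x - K₁ = Real.log x * (1 - K₁ * v) := by
    rw [hv]; field_simp
  have hQ : 0 ≤ Q := by
    refine le_trans ?_ h1
    rw [hLv]
    have : 0 ≤ 1 - K₁ * v := by linarith
    positivity
  calc _ ≤ Real.exp Real.eulerMascheroniConstant * Real.log x *
          ((1 - K₁ * v) * (1 - K₂ * u)) := by
        apply mul_le_mul_of_nonneg_left _ (by positivity)
        nlinarith [mul_nonneg a2 a3]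
    _ = Real.exp Real.eulerMascheroniConstant * (Real.log x - K₁) * (1 - K₂ * u) := by
        rw [hLv]; ring
    _ ≤ Q * (1 - K₂ * u) := mul_le_mul_of_nonneg_right h1 (by linarith)
    _ ≤ Q * (1 - S / b) := mul_le_mul_of_nonneg_left (by linarith) hQ
    _ ≤ _ := hprod

theorem sum_filter_le_one_add_log {D : Finset ℕ} {w : ℕ → ℝ} (hD : 0 ∉ D)
    (hw : ∀ k ∈ D, w k ≤ ((k : ℝ))⁻¹) {y : ℝ} (hy : 1 ≤ y) :
    ∑ k ∈ D with ((k : ℕ) : ℝ) ≤ y, w k ≤ 1 + Real.log y := by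
  calc ∑ k ∈ D with ((k : ℕ) : ℝ) ≤ y, w k
      ≤ ∑ k ∈ D with ((k : ℕ) : ℝ) ≤ y, ((k : ℝ))⁻¹ :=
        Finset.sum_le_sum fun k hk => hw k (Finset.mem_filter.1 hk).1
    _ ≤ ∑ k ∈ Icc 1 ⌊y⌋₊, ((k : ℝ))⁻¹ := by
        apply Finset.sum_le_sum_of_subset_of_nonneg
        · intro k hk
          obtain ⟨hkD, hky⟩ := Finset.mem_filter.1 hk
          rw [Finset.mem_Icc]
          exact ⟨Nat.one_le_iff_ne_zero.2 fun h => hD (h ▸ hkD), Nat.le_floor hky⟩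
        · intro k _ _
          positivity
    _ = (harmonic ⌊y⌋₊ : ℝ) := by
        rw [harmonic_eq_sum_Icc]
        push_cast
        rfl
    _ ≤ _ := harmonic_floor_le_one_add_log y hy

theorem log_pow_mul_le_sum_mul_log_pow {D : Finset ℕ} {w : ℕ → ℝ} (hD : 0 ∉ D)
    (hw0 : ∀ k ∈ D, 0 ≤ w k) (hw : ∀ k ∈ D, w k ≤ ((k : ℝ))⁻¹) {x : ℝ} (hx : 1 ≤ x) (ℓ : ℕ) :
    Real.log x ^ ℓ * (∑ k ∈ D, w k - (1 + Real.log x)) ≤ ∑ k ∈ D, w k * Real.log k ^ ℓ := by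
  have hL : 0 ≤ Real.log x := Real.log_nonneg hx
  have h1 := sum_filter_le_one_add_log hD hw hx
  rw [Finset.sum_filter] at h1
  have h2 : Real.log x ^ ℓ * (∑ k ∈ D, w k - ∑ k ∈ D, if (k : ℝ) ≤ x then w k else 0) ≤
      ∑ k ∈ D, w k * Real.log k ^ ℓ := by
    rw [← Finset.sum_sub_distrib, Finset.mul_sum]
    apply Finset.sum_le_sum
    intro k hk
    have hk0 := hw0 k hk
    have hlk := Real.log_natCast_nonneg k
    split_ifs with h
    · rw [sub_self, mul_zero]
      positivity
    · rw [sub_zero, mul_comm]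
      have := Real.log_le_log (by linarith) (le_of_not_ge h)
      gcongr
  refine le_trans (mul_le_mul_of_nonneg_left ?_ (by positivity)) h2
  linarith

theorem log_mul_le_sum_mul_log {D : Finset ℕ} {w : ℕ → ℝ} (hD : 0 ∉ D)
    (hw0 : ∀ k ∈ D, 0 ≤ w k) (hw : ∀ k ∈ D, w k ≤ ((k : ℝ))⁻¹) {x : ℝ} (hx : 1 ≤ x) :
    Real.log x * (∑ k ∈ D, w k - 3 / 4 * Real.log x - 1) ≤ ∑ k ∈ D, w k * Real.log k := by
  have hL : 0 ≤ Real.log x := Real.log_nonneg hx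
  have hsq : 1 ≤ √x := Real.one_le_sqrt.2 hx
  have hlsq : Real.log √x = Real.log x / 2 := Real.log_sqrt (by linarith)
  have h1 := sum_filter_le_one_add_log hD hw hx
  have h1' := sum_filter_le_one_add_log hD hw hsq
  rw [Finset.sum_filter] at h1 h1'
  rw [hlsq] at h1'
  have h2 : Real.log x / 2 * ((∑ k ∈ D, w k - ∑ k ∈ D, if (k : ℝ) ≤ x then w k else 0) +
      (∑ k ∈ D, w k - ∑ k ∈ D, if (k : ℝ) ≤ √x then w k else 0)) ≤
      ∑ k ∈ D, w k * Real.log k := by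
    rw [← Finset.sum_sub_distrib, ← Finset.sum_sub_distrib, ← Finset.sum_add_distrib,
      Finset.mul_sum]
    apply Finset.sum_le_sum
    intro k hk
    have hk0 := hw0 k hk
    have hlk := Real.log_natCast_nonneg k
    have hb1 : ¬ (k : ℝ) ≤ x → Real.log x ≤ Real.log k := fun h =>
      Real.log_le_log (by linarith) (le_of_not_ge h)
    have hb2 : ¬ (k : ℝ) ≤ √x → Real.log x / 2 ≤ Real.log k := fun h =>
      hlsq ▸ Real.log_le_log (by linarith) (le_of_not_ge h)
    split_ifs with h h' h'
    · rw [sub_self, add_zero, mul_zero]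
      positivity
    · nlinarith [mul_le_mul_of_nonneg_left (hb2 h') hk0]
    · nlinarith [mul_le_mul_of_nonneg_left (hb1 h) hk0]
    · nlinarith [mul_le_mul_of_nonneg_left (hb1 h) hk0]
  nlinarith

theorem sum_divisors_sum_divisors_eq (P : ℕ) (h : ℕ → ℝ) :
    ∑ m ∈ P.divisors, ∑ k ∈ m.divisors, h k =
      ∑ k ∈ P.divisors, (#{m ∈ P.divisors | k ∣ m} : ℝ) * h k := by
  rw [Finset.sum_comm' (t' := P.divisors) (s' := fun k => {m ∈ P.divisors | k ∣ m})]
  · simp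
  · intro m k
    simp only [Nat.mem_divisors, Finset.mem_filter]
    constructor
    · rintro ⟨⟨h1, h2⟩, h3, h4⟩
      exact ⟨⟨⟨h1, h2⟩, h3⟩, h3.trans h1, h2⟩
    · rintro ⟨⟨⟨h1, h2⟩, h3⟩, _⟩
      exact ⟨⟨h1, h2⟩, h3, ne_zero_of_dvd_ne_zero h2 h1⟩

/-- lower bound for the weighted reciprocal sum `S(x; ℓ)/|M|`. -/
theorem weighted_reciprocal_sum_lower_bound :
    ∃ C : ℝ, 0 < C ∧ ∀ x : ℝ, 3 ≤ x → ∀ b J ℓ : ℕ, 1 ≤ b → 1 ≤ J →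
      (1 / ((resonatorProd x b).divisors.card : ℝ)) *
          ∑ m ∈ (resonatorProd x b).divisors, ∑ k ∈ m.divisors,
            (Real.log k) ^ ℓ / (k : ℝ)
        ≥ (Real.exp Real.eulerMascheroniConstant / (ℓ + 1)) *
            (1 - C * (1 / (J : ℝ) + (J : ℝ) * Real.log (Real.log x) / (b : ℝ)
              + (J : ℝ) ^ 2 / Real.log x)) * (Real.log x) ^ (ℓ + 1) := by
  obtain ⟨K, hK0, hK⟩ := exists_exp_eulerMascheroniConstant_mul_log_mul_le_average
  refine ⟨100 * (K + 1), by positivity, fun x hx b J ℓ hb hJ => ?_⟩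
  have hb0 : (0 : ℝ) < b := by exact_mod_cast hb
  have hJ1 : (1 : ℝ) ≤ J := by exact_mod_cast hJ
  have hL : 0 < Real.log x := Real.log_pos (by linarith)
  have hLL : 0 ≤ Real.log (Real.log x) := log_log_three_pos.le.trans (log_log_three_le hx)
  have hγ : (1.6 : ℝ) ≤ Real.exp Real.eulerMascheroniConstant := by
    have h1 := Real.quadratic_le_exp_of_nonneg (x := 1 / 2) (by norm_num)
    have h2 := Real.exp_le_exp.2 Real.one_half_lt_eulerMascheroniConstant.le
    norm_num at h1
    linarith
  have hZ := hK x hx b hb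
  set E := Real.exp Real.eulerMascheroniConstant
  set L := Real.log x
  set P := resonatorProd x b
  have hu : Real.log L / b ≤ J * Real.log L / b :=
    div_le_div_of_nonneg_right (le_mul_of_one_le_left hLL hJ1) hb0.le
  have hv : 1 / L ≤ (J : ℝ) ^ 2 / L :=
    div_le_div_of_nonneg_right (one_le_pow₀ hJ1) hL.le
  have hu0 : 0 ≤ Real.log L / b := by positivity
  have hJ0 : 0 ≤ 1 / (J : ℝ) := by positivity
  have hδε : Real.log L / b + 1 / L ≤ 1 / (J : ℝ) + J * Real.log L / b + (J : ℝ) ^ 2 / L := by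
    linarith
  have hvε : 1 / L ≤ 1 / (J : ℝ) + J * Real.log L / b + (J : ℝ) ^ 2 / L := by linarith
  have hv0 : 0 < 1 / L := by positivity
  set ε := 1 / (J : ℝ) + J * Real.log L / b + (J : ℝ) ^ 2 / L
  set δ := Real.log L / b + 1 / L
  set w : ℕ → ℝ := fun k => 1 / (#P.divisors : ℝ) * (#{m ∈ P.divisors | k ∣ m} : ℝ) * ((k : ℝ))⁻¹
    with hwdef
  have hw0 : ∀ k ∈ P.divisors, 0 ≤ w k := fun k _ => by positivity
  have hw : ∀ k ∈ P.divisors, w k ≤ ((k : ℝ))⁻¹ := fun k _ => by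
    apply mul_le_of_le_one_left (by positivity)
    rw [one_div_mul_eq_div]
    apply div_le_one_of_le₀ _ (by positivity)
    exact_mod_cast Finset.card_filter_le _ _
  have hD : 0 ∉ P.divisors := by simp
  have hsum : ∀ n : ℕ, 1 / (#P.divisors : ℝ) *
      ∑ m ∈ P.divisors, ∑ k ∈ m.divisors, Real.log k ^ n / (k : ℝ) =
        ∑ k ∈ P.divisors, w k * Real.log k ^ n := fun n => by
    rw [sum_divisors_sum_divisors_eq, Finset.mul_sum]
    apply Finset.sum_congr rfl
    intro k _
    simp only [hwdef]
    ring
  have hZw : E * L * (1 - K * δ) ≤ ∑ k ∈ P.divisors, w k := by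
    refine hZ.trans_eq ?_
    have := hsum 0
    simp only [pow_zero, mul_one] at this
    rw [← this]
    simp
  rw [hsum, ge_iff_le]
  have hE0 : 0 < E := by linarith
  by_cases hneg : 1 - 100 * (K + 1) * ε ≤ 0
  · refine le_trans (mul_nonpos_of_nonpos_of_nonneg
      (mul_nonpos_of_nonneg_of_nonpos (by positivity) hneg) (by positivity)) ?_
    exact Finset.sum_nonneg fun k hk =>
      mul_nonneg (hw0 k hk) (pow_nonneg (Real.log_natCast_nonneg k) _)
  push Not at hneg
  have hKε : K * δ ≤ K * ε := mul_le_mul_of_nonneg_left hδε hK0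
  have hKε0 : 0 ≤ K * ε := mul_nonneg hK0 (by linarith)
  rcases Nat.eq_zero_or_pos ℓ with rfl | hℓ
  · simp only [pow_zero, mul_one, Nat.cast_zero, zero_add, div_one, pow_one]
    refine le_trans ?_ hZw
    rw [mul_right_comm]
    apply mul_le_mul_of_nonneg_left _ (by positivity)
    nlinarith
  have hKδ : K * δ ≤ 1 / 100 := by nlinarith
  have hv1 : 1 / L ≤ 1 / 100 := by nlinarith
  have hLv : L * (1 / L) = 1 := mul_one_div_cancel hL.ne'
  have hZ1 : L * (E * (99 / 100)) ≤ ∑ k ∈ P.divisors, w k := by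
    refine le_trans ?_ hZw
    rw [mul_comm E L, mul_assoc]
    apply mul_le_mul_of_nonneg_left _ hL.le
    exact mul_le_mul_of_nonneg_left (by linarith) hE0.le
  have hone : 1 ≤ L * (1 / 100) := by
    have := mul_le_mul_of_nonneg_left hv1 hL.le
    rwa [hLv] at this
  have hdrop : E / (ℓ + 1) * (1 - 100 * (K + 1) * ε) * L ^ (ℓ + 1) ≤
      L ^ ℓ * (L * (E / (ℓ + 1))) := by
    have : E / (ℓ + 1) * (1 - 100 * (K + 1) * ε) ≤ E / (ℓ + 1) :=
      mul_le_of_le_one_right (by positivity) (by nlinarith)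
    calc _ ≤ E / (ℓ + 1) * L ^ (ℓ + 1) := mul_le_mul_of_nonneg_right this (by positivity)
      _ = _ := by ring
  refine hdrop.trans ?_
  rcases (Nat.succ_le_of_lt hℓ).eq_or_lt with h1 | h2
  · subst h1
    simp only [Nat.succ_eq_add_one, zero_add, pow_one, Nat.cast_one]
    refine le_trans ?_ (log_mul_le_sum_mul_log hD hw0 hw (x := x) (by linarith))
    apply mul_le_mul_of_nonneg_left _ hL.le
    have : L * (E * (99 / 100) - 3 / 4 - 1 / 100 - E / (1 + 1)) ≥ 0 :=
      mul_nonneg hL.le (by linarith)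
    change _ ≤ _ - 3 / 4 * L - 1
    linarith
  · refine le_trans ?_ (log_pow_mul_le_sum_mul_log_pow hD hw0 hw (x := x) (by linarith) ℓ)
    apply mul_le_mul_of_nonneg_left _ (by positivity)
    have hℓ2 : (2 : ℝ) ≤ ℓ := by exact_mod_cast h2
    have hE3 : E / (ℓ + 1) ≤ E / 3 := div_le_div_of_nonneg_left hE0.le (by norm_num) (by linarith)
    have : L * (E * (99 / 100) - 1 - 1 / 100 - E / (ℓ + 1)) ≥ 0 :=
      mul_nonneg hL.le (by linarith)
    change _ ≤ _ - (1 + L)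
    linarith
end

section
/- There is an absolute constant C > 0 such that for all real x ≥ 3 and all integers b ≥ 1: |∏_{p ≤ x} Σ_{ν=0}^{b−1} (1 − ν/b) p^{−ν} − e^γ log x| ≤ C · ((log log x)/b + 1/(log x)) · e^γ log x. -/
open Finset Real

open Filter Topology MeasureTheory

/-- The logarithm of the Euler factor at `n` of `ζ` at `1` if `n` is prime, and `0` otherwise. -/
noncomputable def eulerLog (n : ℕ) : ℝ :=
  if n.Prime then -Real.log (1 - (n : ℝ)⁻¹) else 0

lemma inv_le_neg_log_one_sub_inv {x : ℝ} (hx : 1 < x) : x⁻¹ ≤ -Real.log (1 - x⁻¹) := by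
  have h1 : 0 < 1 - x⁻¹ := sub_pos.2 (inv_lt_one_of_one_lt₀ hx)
  linarith [Real.log_le_sub_one_of_pos h1]

lemma neg_log_one_sub_inv_le {x : ℝ} (hx : 1 < x) : -Real.log (1 - x⁻¹) ≤ (x - 1)⁻¹ := by
  have h1 : 0 < 1 - x⁻¹ := sub_pos.2 (inv_lt_one_of_one_lt₀ hx)
  have h2 := Real.one_sub_inv_le_log_of_pos h1
  have h3 : (1 - x⁻¹)⁻¹ = 1 + (x - 1)⁻¹ := by
    have : x - 1 ≠ 0 := by linarith
    have : x ≠ 0 := by linarith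
    field_simp
    ring
  linarith

lemma eulerLog_nonneg (n : ℕ) : 0 ≤ eulerLog n := by
  unfold eulerLog
  split_ifs with h
  · have h1 : (1 : ℝ) < n := by exact_mod_cast h.one_lt
    exact (inv_nonneg.2 (by positivity)).trans (inv_le_neg_log_one_sub_inv h1)
  · rfl

lemma log_factorial_eq_sum (n : ℕ) :
    Real.log (n.factorial) = ∑ k ∈ range (n + 1),
      if k.Prime then ((n.factorial).factorization k : ℝ) * Real.log k else 0 := by
  rw [Real.log_nat_eq_sum_factorization, Finsupp.sum_of_support_subset (s := range (n + 1))]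
  · refine sum_congr rfl fun k _ ↦ ?_
    split_ifs with h
    · rfl
    · simp [Nat.factorization_eq_zero_of_not_prime _ h]
  · intro p hp
    have h := Nat.prime_of_mem_primeFactors (Nat.support_factorization _ ▸ hp)
    have h2 := Nat.dvd_of_mem_primeFactors (Nat.support_factorization _ ▸ hp)
    exact mem_range.2 (Nat.lt_succ_of_le ((h.dvd_factorial).1 h2))
  · simp

lemma div_le_factorization_factorial {p : ℕ} (hp : p.Prime) (n : ℕ) :
    n / p ≤ (n.factorial).factorization p := by
  rw [Nat.factorization_factorial hp (b := Nat.log p n + 2) (by omega)]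
  refine le_trans (by simp) (single_le_sum (f := fun i ↦ n / p ^ i) (fun _ _ ↦ Nat.zero_le _)
    (show 1 ∈ Ico 1 (Nat.log p n + 2) by simp))

lemma exists_sum_log_div_le : ∃ K : ℝ, ∀ n : ℕ,
    ∑ k ∈ range (n + 1), (if k.Prime then Real.log k * ((k - 1 : ℝ)⁻¹ - (k : ℝ)⁻¹) else 0) ≤ K := by
  have hs : Summable fun k : ℕ ↦ 4 * (k : ℝ) ^ (-(3 / 2) : ℝ) :=
    (Real.summable_nat_rpow.2 (by norm_num)).mul_left 4
  refine ⟨∑' k : ℕ, 4 * (k : ℝ) ^ (-(3 / 2) : ℝ), fun n ↦ ?_⟩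
  refine le_trans (sum_le_sum fun k _ ↦ ?_) (hs.sum_le_tsum (range (n + 1))
    fun _ _ ↦ by positivity)
  split_ifs with h
  · have h2 : (2 : ℝ) ≤ k := by exact_mod_cast h.two_le
    have h0 : (0 : ℝ) < k := by linarith
    have e1 : (k - 1 : ℝ)⁻¹ - (k : ℝ)⁻¹ ≤ 2 * (k : ℝ) ^ (-2 : ℝ) := by
      rw [Real.rpow_neg h0.le, Real.rpow_two]
      have : (k - 1 : ℝ) ≠ 0 := by linarith
      rw [inv_sub_inv this h0.ne', ← div_eq_mul_inv, div_le_div_iff₀ (by nlinarith) (by positivity)]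
      nlinarith
    have e2 := Real.log_le_rpow_div h0.le (ε := 1 / 2) (by norm_num)
    have e3 : (k : ℝ) ^ (-(3 / 2) : ℝ) = (k : ℝ) ^ (1 / 2 : ℝ) * (k : ℝ) ^ (-2 : ℝ) := by
      rw [← Real.rpow_add h0]; norm_num
    have e4 : 0 ≤ (k : ℝ) ^ (-2 : ℝ) := by positivity
    calc _ ≤ Real.log k * (2 * (k : ℝ) ^ (-2 : ℝ)) :=
          mul_le_mul_of_nonneg_left e1 (Real.log_nonneg (by linarith))
      _ ≤ ((k : ℝ) ^ (1 / 2 : ℝ) / (1 / 2)) * (2 * (k : ℝ) ^ (-2 : ℝ)) :=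
          mul_le_mul_of_nonneg_right e2 (by positivity)
      _ = _ := by rw [e3]; ring
  · positivity

/-- The first theorem of Mertens, weighted by logarithms of Euler factors. -/
lemma exists_abs_sum_eulerLog_mul_log_sub_log_le : ∃ K : ℝ, ∀ n : ℕ, 1 ≤ n →
    |∑ k ∈ range (n + 1), eulerLog k * Real.log k - Real.log n| ≤ K := by
  obtain ⟨K, hK⟩ := exists_sum_log_div_le
  refine ⟨K + Real.log 4 + 1, fun n hn ↦ ?_⟩
  have hn0 : (0 : ℝ) < n := by exact_mod_cast hn
  have hl4 : 0 ≤ Real.log 4 := Real.log_nonneg (by norm_num)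
  have hK0 : 0 ≤ K := le_trans (sum_nonneg fun k _ ↦ by
    split_ifs with h
    · have h2 : (2 : ℝ) ≤ k := by exact_mod_cast h.two_le
      exact mul_nonneg (Real.log_nonneg (by linarith))
        (sub_nonneg.2 (inv_anti₀ (by linarith) (by linarith)))
    · rfl) (hK n)
  have hfac : ∀ k : ℕ, k.Prime → (1 : ℝ) < k ∧ 0 ≤ Real.log k := fun k h ↦ by
    have h1 : (1 : ℝ) < k := by exact_mod_cast h.one_lt
    exact ⟨h1, Real.log_nonneg h1.le⟩
  have hup : Real.log n.factorial ≤ n * Real.log n := by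
    rw [← Real.log_pow]
    exact Real.log_le_log (by positivity) (by exact_mod_cast Nat.factorial_le_pow n)
  have hlow : n * Real.log n - n ≤ Real.log n.factorial := by
    have h := Real.pow_div_factorial_le_exp (n : ℝ) hn0.le n
    have h2 := Real.log_le_log (by positivity) h
    rw [Real.log_exp, Real.log_div (by positivity) (by positivity), Real.log_pow] at h2
    linarith
  have hth := Chebyshev.theta_le_log4_mul_x hn0.le
  have hth' : Chebyshev.theta n = ∑ k ∈ range (n + 1), if k.Prime then Real.log k else 0 := by
    rw [Chebyshev.theta_eq_sum_Icc, Nat.floor_natCast, ← Nat.range_succ_eq_Icc_zero, sum_filter]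
  set T := ∑ k ∈ range (n + 1), (if k.Prime then Real.log k * (k : ℝ)⁻¹ else 0) with hT
  set T' := ∑ k ∈ range (n + 1), (if k.Prime then Real.log k * (k - 1 : ℝ)⁻¹ else 0) with hT'
  have hTT' : T' - T ≤ K := by
    refine le_trans (le_of_eq ?_) (hK n)
    rw [hT, hT', ← sum_sub_distrib]
    refine sum_congr rfl fun k _ ↦ ?_
    split_ifs <;> ring
  have h1 : T ≤ ∑ k ∈ range (n + 1), eulerLog k * Real.log k := by
    refine sum_le_sum fun k _ ↦ ?_
    unfold eulerLog
    split_ifs with h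
    · rw [mul_comm]
      exact mul_le_mul_of_nonneg_right (inv_le_neg_log_one_sub_inv (hfac k h).1) (hfac k h).2
    · simp
  have h2 : ∑ k ∈ range (n + 1), eulerLog k * Real.log k ≤ T' := by
    refine sum_le_sum fun k _ ↦ ?_
    unfold eulerLog
    split_ifs with h
    · rw [mul_comm]
      exact mul_le_mul_of_nonneg_left (neg_log_one_sub_inv_le (hfac k h).1) (hfac k h).2
    · simp
  have h3 : n * T - Chebyshev.theta n ≤ Real.log n.factorial := by
    rw [log_factorial_eq_sum, hth', hT, mul_sum, ← sum_sub_distrib]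
    refine sum_le_sum fun k _ ↦ ?_
    split_ifs with h
    · have e : (n : ℝ) / k - 1 ≤ ((n.factorial).factorization k : ℝ) := by
        refine le_trans ?_ (Nat.cast_le.2 (div_le_factorization_factorial h n))
        have := Nat.lt_floor_add_one ((n : ℝ) / k)
        rw [Nat.floor_div_eq_div] at this
        linarith
      calc _ = ((n : ℝ) / k - 1) * Real.log k := by ring
        _ ≤ _ := mul_le_mul_of_nonneg_right e (hfac k h).2
    · simp
  have h4 : Real.log n.factorial ≤ n * T' := by
    rw [log_factorial_eq_sum, hT', mul_sum]
    refine sum_le_sum fun k _ ↦ ?_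
    split_ifs with h
    · have e : ((n.factorial).factorization k : ℝ) ≤ n / (k - 1 : ℝ) := by
        refine le_trans (Nat.cast_le.2 (Nat.factorization_factorial_le_div_pred h n)) ?_
        refine Nat.cast_div_le.trans ?_
        rw [Nat.cast_sub h.one_le, Nat.cast_one]
      calc _ ≤ n / (k - 1 : ℝ) * Real.log k := mul_le_mul_of_nonneg_right e (hfac k h).2
        _ = _ := by ring
    · simp
  have h5 : T ≤ Real.log n + Real.log 4 := by
    refine le_of_mul_le_mul_left ?_ hn0
    linarith
  have h6 : Real.log n - 1 ≤ T' := by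
    refine le_of_mul_le_mul_left ?_ hn0
    linarith
  rw [abs_le]
  constructor <;> linarith

/-- If increments of `G` are dominated by the decrements of a nonnegative null sequence `w`, then
`G` converges at rate `w`. -/
lemma exists_abs_sub_le_of_abs_succ_sub_le {G w : ℕ → ℝ} {m : ℕ} {K : ℝ}
    (hw0 : ∀ n, m ≤ n → 0 ≤ w n) (hw : Tendsto w atTop (𝓝 0)) (hK : 0 ≤ K)
    (h : ∀ n, m ≤ n → |G (n + 1) - G n| ≤ K * (w n - w (n + 1))) :
    ∃ c : ℝ, ∀ n, m ≤ n → |G n - c| ≤ K * w n := by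
  have key : ∀ n, m ≤ n → ∀ k, |G (n + k) - G n| ≤ K * (w n - w (n + k)) := by
    intro n hn k
    induction k with
    | zero => simp
    | succ k ih =>
      have h1 := h (n + k) (by omega)
      have h2 := abs_sub_le (G (n + (k + 1))) (G (n + k)) (G n)
      rw [← add_assoc] at *
      linarith
  have key' : ∀ n, m ≤ n → ∀ l, n ≤ l → |G l - G n| ≤ K * w n := by
    intro n hn l hl
    obtain ⟨k, rfl⟩ := Nat.exists_eq_add_of_le hl
    have h1 := key n hn k
    have h2 := mul_nonneg hK (hw0 (n + k) (by omega))
    linarith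
  have hKw : Tendsto (fun n ↦ K * w n) atTop (𝓝 0) := by simpa using hw.const_mul K
  have hc : CauchySeq G := by
    refine Metric.cauchySeq_iff'.2 fun ε hε ↦ ?_
    obtain ⟨N, hN⟩ := ((hKw.eventually (gt_mem_nhds hε)).and (eventually_ge_atTop m)).exists
    exact ⟨N, fun l hl ↦ (key' N hN.2 l hl).trans_lt hN.1⟩
  obtain ⟨c, hc⟩ := cauchySeq_tendsto_of_complete hc
  refine ⟨c, fun n hn ↦ ?_⟩
  have h1 : Tendsto (fun l ↦ |G l - G n|) atTop (𝓝 |c - G n|) := (hc.sub_const _).abs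
  rw [abs_sub_comm]
  exact le_of_tendsto h1 (eventually_atTop.2 ⟨n, fun l hl ↦ key' n hn l hl⟩)

lemma log_log_sub_log_log_le {x y : ℝ} (hx : 1 < x) (hxy : x ≤ y) :
    Real.log (Real.log y) - Real.log (Real.log x) ≤ (Real.log y - Real.log x) / Real.log x := by
  have h1 := Real.log_pos hx
  have h2 := Real.log_pos (hx.trans_le hxy)
  rw [← Real.log_div h2.ne' h1.ne', sub_div, div_self h1.ne']
  exact Real.log_le_sub_one_of_pos (by positivity)

lemma le_log_log_sub_log_log {x y : ℝ} (hx : 1 < x) (hxy : x ≤ y) :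
    (Real.log y - Real.log x) / Real.log y ≤ Real.log (Real.log y) - Real.log (Real.log x) := by
  have h1 := Real.log_pos hx
  have h2 := Real.log_pos (hx.trans_le hxy)
  rw [← Real.log_div h2.ne' h1.ne', sub_div, div_self h2.ne', ← inv_div]
  exact Real.one_sub_inv_le_log_of_pos (by positivity)

lemma log_succ_sub_log_le_one {n : ℕ} (hn : 1 ≤ n) :
    Real.log (n + 1 : ℕ) - Real.log n ≤ 1 := by
  have h0 : (1 : ℝ) ≤ n := by exact_mod_cast hn
  rw [← Real.log_div (by positivity) (by positivity)]
  refine (Real.log_le_sub_one_of_pos (by positivity)).trans ?_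
  push_cast
  rw [add_div, div_self (by positivity)]
  have := (div_le_one (by positivity : (0 : ℝ) < n)).2 h0
  linarith

lemma exists_abs_sum_eulerLog_nat_sub_le : ∃ c K : ℝ, ∀ n : ℕ, 2 ≤ n →
    |∑ k ∈ range (n + 1), eulerLog k - Real.log (Real.log n) - c| ≤ K / Real.log n := by
  obtain ⟨K, hK⟩ := exists_abs_sum_eulerLog_mul_log_sub_log_le
  have hK0 : 0 ≤ K := (abs_nonneg _).trans (hK 1 le_rfl)
  set R : ℕ → ℝ := fun n ↦ ∑ k ∈ range (n + 1), eulerLog k * Real.log k - Real.log n with hR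
  set w : ℕ → ℝ := fun n ↦ (Real.log n)⁻¹ with hw
  set G : ℕ → ℝ := fun n ↦
    ∑ k ∈ range (n + 1), eulerLog k - Real.log (Real.log n) - R n * w n with hG
  have hpos : ∀ n : ℕ, 2 ≤ n → 0 < Real.log n := fun n hn ↦
    Real.log_pos (by exact_mod_cast hn)
  obtain ⟨c, hc⟩ := exists_abs_sub_le_of_abs_succ_sub_le (G := G) (w := w) (m := 2) (K := K + 1)
    (fun n hn ↦ (inv_pos.2 (hpos n hn)).le)
    ((Real.tendsto_log_atTop.comp tendsto_natCast_atTop_atTop).inv_tendsto_atTop)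
    (by positivity) (by
      intro n hn
      have h1 := hpos n hn
      have h2 := hpos (n + 1) (by omega)
      have hn1 : (1 : ℝ) < n := by exact_mod_cast hn
      have hle : (n : ℝ) ≤ (n + 1 : ℕ) := by push_cast; linarith
      have hlog : Real.log n ≤ Real.log (n + 1 : ℕ) := Real.log_le_log (by linarith) hle
      have hww : w (n + 1) ≤ w n := inv_anti₀ h1 hlog
      have a1 := log_log_sub_log_log_le hn1 hle
      have a2 := le_log_log_sub_log_log hn1 hle
      have a3 := log_succ_sub_log_le_one (n := n) (by omega)
      have hRn := abs_le.1 (hK n (by omega))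
      set e := (Real.log (n + 1 : ℕ) - Real.log n) * w (n + 1) -
        (Real.log (Real.log (n + 1 : ℕ)) - Real.log (Real.log n)) with he
      have hid : G (n + 1) - G n = R n * (w n - w (n + 1)) + e := by
        have h3 : Real.log (n + 1 : ℕ) * w (n + 1) = 1 := mul_inv_cancel₀ h2.ne'
        simp only [hG, hR, he, sum_range_succ _ (n + 1)]
        linear_combination (-eulerLog (n + 1)) * h3
      have he0 : e ≤ 0 := by
        rw [he, hw]; simp only [← div_eq_mul_inv]; linarith
      have he1 : -(w n - w (n + 1)) ≤ e := by
        have : (Real.log (n + 1 : ℕ) - Real.log n) * (w n - w (n + 1)) ≤ 1 * (w n - w (n + 1)) :=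
          mul_le_mul_of_nonneg_right a3 (by linarith)
        rw [div_eq_mul_inv] at a1
        change _ ≤ _ * w n at a1
        rw [he]; linarith
      rw [hid, abs_le]
      have b1 := mul_le_mul_of_nonneg_right hRn.1 (sub_nonneg.2 hww)
      have b2 := mul_le_mul_of_nonneg_right hRn.2 (sub_nonneg.2 hww)
      constructor <;> linarith)
  refine ⟨c, 2 * K + 1, fun n hn ↦ ?_⟩
  have h1 := abs_le.1 (hc n hn)
  have hw0 : 0 ≤ w n := (inv_pos.2 (hpos n hn)).le
  have hRn := abs_le.1 (hK n (by omega))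
  have b1 := mul_le_mul_of_nonneg_right hRn.1 hw0
  have b2 := mul_le_mul_of_nonneg_right hRn.2 hw0
  rw [div_eq_mul_inv, abs_le]
  simp only [hG, hR] at h1 b1 b2
  change _ ≤ _ ∧ _ ≤ (2 * K + 1) * w n
  constructor <;> linarith

lemma log_le_two_mul_log_floor {x : ℝ} (hx : 2 ≤ x) : Real.log x ≤ 2 * Real.log ⌊x⌋₊ := by
  have h2 : (2 : ℝ) ≤ (⌊x⌋₊ : ℕ) := by exact_mod_cast Nat.le_floor (by exact_mod_cast hx)
  have h3 := Nat.lt_floor_add_one x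
  rw [show (2 : ℝ) * Real.log ⌊x⌋₊ = Real.log ((⌊x⌋₊ : ℝ) ^ 2) by rw [Real.log_pow]; norm_num]
  exact Real.log_le_log (by linarith) (by nlinarith)

lemma exists_abs_sum_eulerLog_sub_le : ∃ c K : ℝ, ∀ x : ℝ, 2 ≤ x →
    |∑ k ∈ range (⌊x⌋₊ + 1), eulerLog k - Real.log (Real.log x) - c| ≤ K / Real.log x := by
  obtain ⟨c, K, h⟩ := exists_abs_sum_eulerLog_nat_sub_le
  refine ⟨c, 2 * K + 2, fun x hx ↦ ?_⟩
  have h2 : 2 ≤ ⌊x⌋₊ := Nat.le_floor (by exact_mod_cast hx)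
  have h2' : (2 : ℝ) ≤ (⌊x⌋₊ : ℕ) := by exact_mod_cast h2
  have hfl := Nat.floor_le (by linarith : 0 ≤ x)
  have hfl' := Nat.lt_floor_add_one x
  have hL := Real.log_pos (by linarith : 1 < x)
  have hM := Real.log_pos (by linarith : 1 < (⌊x⌋₊ : ℝ))
  have hLM := log_le_two_mul_log_floor hx
  have hML : Real.log ⌊x⌋₊ ≤ Real.log x := Real.log_le_log (by linarith) hfl
  have a := h _ h2
  have b1 := log_log_sub_log_log_le (by linarith : 1 < (⌊x⌋₊ : ℝ)) hfl
  have b2 := Real.log_le_log hM hML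
  have b3 : Real.log x - Real.log ⌊x⌋₊ ≤ 1 := by
    refine le_trans (sub_le_sub_right (Real.log_le_log (by linarith) ?_) _)
      (log_succ_sub_log_le_one (n := ⌊x⌋₊) (by omega))
    push_cast; exact hfl'.le
  have hinv : (Real.log ⌊x⌋₊)⁻¹ ≤ 2 * (Real.log x)⁻¹ := by
    rw [← div_eq_mul_inv, inv_le_comm₀ hM (by positivity), inv_div]; linarith
  have b4 : (Real.log x - Real.log ⌊x⌋₊) / Real.log ⌊x⌋₊ ≤ 2 * (Real.log x)⁻¹ := by
    rw [div_eq_mul_inv]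
    refine le_trans (mul_le_mul_of_nonneg_right b3 (inv_pos.2 hM).le) (by linarith)
  have hK0 : 0 ≤ K := by
    have := (div_nonneg_iff.1 ((abs_nonneg _).trans a)).resolve_right (by intro h; linarith [h.2])
    exact this.1
  have b5 : K / Real.log ⌊x⌋₊ ≤ K * (2 * (Real.log x)⁻¹) :=
    mul_le_mul_of_nonneg_left hinv hK0
  rw [abs_le] at a ⊢
  rw [div_eq_mul_inv]
  constructor <;> nlinarith

lemma integrableOn_abs_log_mul_exp_neg :
    IntegrableOn (fun u : ℝ ↦ |Real.log u| * Real.exp (-u)) (Set.Ioi 0) := by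
  have h1 := Real.GammaIntegral_convergent (s := 2) (by norm_num)
  have h2 := Real.GammaIntegral_convergent (s := 1 / 2) (by norm_num)
  refine Integrable.mono' (h1.add (h2.const_mul 2)) (by fun_prop) ?_
  refine (ae_restrict_iff' measurableSet_Ioi).2 (ae_of_all _ fun u hu ↦ ?_)
  have hu : 0 < u := hu
  have a1 := Real.log_le_sub_one_of_pos hu
  have a2 := Real.log_le_rpow_div (inv_pos.2 hu).le (ε := 1 / 2) (by norm_num)
  rw [Real.log_inv, Real.inv_rpow hu.le, ← Real.rpow_neg hu.le] at a2
  have a3 : 0 ≤ u ^ (-(1 / 2) : ℝ) := by positivity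
  have a4 : |Real.log u| ≤ u + 2 * u ^ (-(1 / 2) : ℝ) := by
    rw [abs_le]; constructor <;> linarith
  rw [Real.norm_of_nonneg (by positivity)]
  calc _ ≤ (u + 2 * u ^ (-(1 / 2) : ℝ)) * Real.exp (-u) :=
        mul_le_mul_of_nonneg_right a4 (Real.exp_pos _).le
    _ = _ := by
        simp only [Pi.add_apply]
        norm_num
        ring

lemma integrableOn_log_mul_exp_neg :
    IntegrableOn (fun u : ℝ ↦ Real.log u * Real.exp (-u)) (Set.Ioi 0) := by
  refine integrableOn_abs_log_mul_exp_neg.mono' (by fun_prop) (ae_of_all _ fun u ↦ ?_)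
  rw [norm_mul, Real.norm_eq_abs, Real.norm_of_nonneg (Real.exp_pos _).le]

lemma integral_log_mul_exp_neg :
    ∫ u in Set.Ioi (0 : ℝ), Real.log u * Real.exp (-u) = -Real.eulerMascheroniConstant := by
  have h1 := Complex.hasDerivAt_GammaIntegral (s := 1) (by simp)
  have h2 : Complex.Gamma =ᶠ[𝓝 1] Complex.GammaIntegral := by
    filter_upwards [(isOpen_lt continuous_const Complex.continuous_re).mem_nhds
      (show (0 : ℝ) < (1 : ℂ).re by simp)] with s hs
    exact Complex.Gamma_eq_integral hs
  have h3 := (h1.congr_of_eventuallyEq h2).unique Complex.hasDerivAt_Gamma_one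
  simp only [sub_self, Complex.cpow_zero, one_mul] at h3
  rw [← Complex.ofReal_inj, ← integral_complex_ofReal]
  push_cast at h3 ⊢
  exact h3

lemma summable_eulerLog_mul_rpow {s : ℝ} (hs : 0 < s) :
    Summable fun n : ℕ ↦ eulerLog n * (n : ℝ) ^ (-s) := by
  refine Summable.of_nonneg_of_le (fun n ↦ mul_nonneg (eulerLog_nonneg n) (by positivity))
    (fun n ↦ ?_) ((Real.summable_nat_rpow.2 (by linarith : -(1 + s) < -1)).mul_left 2)
  unfold eulerLog
  split_ifs with h
  · have h2 : (2 : ℝ) ≤ n := by exact_mod_cast h.two_le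
    have a1 := neg_log_one_sub_inv_le (by linarith : (1 : ℝ) < n)
    have a2 : (n - 1 : ℝ)⁻¹ ≤ 2 * (n : ℝ)⁻¹ := by
      rw [← div_eq_mul_inv, inv_le_comm₀ (by linarith) (by positivity), inv_div]; linarith
    rw [neg_add, Real.rpow_add (by linarith), Real.rpow_neg_one, ← mul_assoc]
    exact mul_le_mul_of_nonneg_right (a1.trans a2) (by positivity)
  · simp only [zero_mul]; positivity

lemma natCast_le_exp_div_iff {n : ℕ} (hn : n ≠ 0) {s u : ℝ} (hs : 0 < s) :
    n ≤ ⌊Real.exp (u / s)⌋₊ ↔ s * Real.log n ≤ u := by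
  rw [Nat.le_floor_iff (Real.exp_pos _).le, ← Real.log_le_iff_le_exp (by positivity),
    le_div_iff₀ hs, mul_comm]

/-- A Dirichlet series is the Laplace transform of its summatory function. -/
lemma tsum_eulerLog_mul_rpow_eq_integral {s : ℝ} (hs : 0 < s) :
    ∑' n : ℕ, eulerLog n * (n : ℝ) ^ (-s) = ∫ u in Set.Ioi (0 : ℝ),
      (∑ k ∈ range (⌊Real.exp (u / s)⌋₊ + 1), eulerLog k) * Real.exp (-u) := by
  set F : ℕ → ℝ → ℝ := fun n u ↦
    eulerLog n * (Set.Ici (s * Real.log n)).indicator (fun u ↦ Real.exp (-u)) u with hF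
  have hexp : IntegrableOn (fun u : ℝ ↦ Real.exp (-u)) (Set.Ioi 0) := integrableOn_exp_neg_Ioi 0
  have hFint : ∀ n, IntegrableOn (F n) (Set.Ioi 0) := fun n ↦
    (hexp.indicator measurableSet_Ici).const_mul _
  have hFval : ∀ n, ∫ u in Set.Ioi (0 : ℝ), F n u = eulerLog n * (n : ℝ) ^ (-s) := by
    intro n
    rw [hF, integral_const_mul]
    by_cases h : n.Prime
    · congr 1
      have h1 : (1 : ℝ) < n := by exact_mod_cast h.one_lt
      have h2 : 0 < s * Real.log n := mul_pos hs (Real.log_pos h1)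
      rw [setIntegral_indicator measurableSet_Ici,
        Set.inter_eq_self_of_subset_right (Set.Ici_subset_Ioi.2 h2), integral_Ici_eq_integral_Ioi,
        integral_exp_neg_Ioi, Real.rpow_def_of_pos (by linarith)]
      ring_nf
    · simp [eulerLog, h]
  have hFnn : ∀ n u, 0 ≤ F n u := fun n u ↦
    mul_nonneg (eulerLog_nonneg n) (Set.indicator_nonneg (fun _ _ ↦ (Real.exp_pos _).le) _)
  have h := hasSum_integral_of_summable_integral_norm (F := F)
    (μ := volume.restrict (Set.Ioi 0)) hFint (by
      simp only [Real.norm_of_nonneg (hFnn _ _), hFval]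
      exact summable_eulerLog_mul_rpow hs)
  simp only [hFval] at h
  rw [h.tsum_eq]
  congr 1
  ext u
  rw [tsum_eq_sum (s := range (⌊Real.exp (u / s)⌋₊ + 1)), sum_mul]
  · refine sum_congr rfl fun n hn ↦ ?_
    rcases eq_or_ne n 0 with rfl | hn0
    · simp [hF, eulerLog]
    · have := (natCast_le_exp_div_iff hn0 hs).1 (Nat.lt_succ_iff.1 (mem_range.1 hn))
      simp only [hF]
      rw [Set.indicator_of_mem (Set.mem_Ici.2 this)]
  · intro n hn
    rcases eq_or_ne n 0 with rfl | hn0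
    · simp [hF, eulerLog]
    · have : ¬ s * Real.log n ≤ u := fun h ↦ hn <| mem_range.2 <| Nat.lt_succ_iff.2
        ((natCast_le_exp_div_iff hn0 hs).2 h)
      simp [hF, Set.indicator_of_notMem (show u ∉ Set.Ici (s * Real.log n) from this)]

lemma tendsto_tsum_eulerLog_add_log {c K : ℝ} (h : ∀ x : ℝ, 2 ≤ x →
    |∑ k ∈ range (⌊x⌋₊ + 1), eulerLog k - Real.log (Real.log x) - c| ≤ K / Real.log x) :
    Tendsto (fun s : ℝ ↦ ∑' n : ℕ, eulerLog n * (n : ℝ) ^ (-s) + Real.log s) (𝓝[>] 0)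
      (𝓝 (c - Real.eulerMascheroniConstant)) := by
  have hl2 : 0 < Real.log 2 := Real.log_pos (by norm_num)
  have hl2' : Real.log 2 < 1 := Real.log_two_lt_d9.trans (by norm_num)
  have hK0 : 0 ≤ K := by
    have := (div_nonneg_iff.1 ((abs_nonneg _).trans (h 2 le_rfl))).resolve_right
      (by intro h; linarith [h.2])
    exact this.1
  set A : ℝ → ℝ := fun x ↦ ∑ k ∈ range (⌊x⌋₊ + 1), eulerLog k with hA
  have hAm : Measurable A :=
    (measurable_from_nat (f := fun n ↦ ∑ k ∈ range (n + 1), eulerLog k)).comp Nat.measurable_floor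
  have hAexp : ∀ s u : ℝ, 0 < s → s * Real.log 2 ≤ u →
      |A (Real.exp (u / s)) + Real.log s - (Real.log u + c)| ≤ K * s / u := by
    intro s u hs hu
    have hu0 : 0 < u := (mul_pos hs hl2).trans_le hu
    have h2 : 2 ≤ Real.exp (u / s) := by
      rw [← Real.log_le_iff_le_exp (by norm_num), le_div_iff₀ hs, mul_comm]; exact hu
    have := h _ h2
    rw [Real.log_exp, Real.log_div hu0.ne' hs.ne', div_div_eq_mul_div] at this
    convert this using 2
    simp only [hA]
    ring
  have hA0 : ∀ s u : ℝ, 0 < s → u < s * Real.log 2 → A (Real.exp (u / s)) = 0 := by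
    intro s u hs hu
    have h2 : Real.exp (u / s) < 2 := by
      rw [← Real.lt_log_iff_exp_lt (by norm_num), div_lt_iff₀ hs, mul_comm]; exact hu
    refine sum_eq_zero fun k hk ↦ ?_
    have h3 : ⌊Real.exp (u / s)⌋₊ < 2 := Nat.floor_lt' (by norm_num) |>.2 (by exact_mod_cast h2)
    have h4 := mem_range.1 hk
    have h5 : ¬ k.Prime := fun hp ↦ by have := hp.two_le; omega
    simp [eulerLog, h5]
  set Φ : ℝ → ℝ → ℝ := fun s u ↦ (A (Real.exp (u / s)) + Real.log s) * Real.exp (-u) with hΦ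
  set bd : ℝ → ℝ := fun u ↦ |Real.log u| * Real.exp (-u) +
    (|c| + K / Real.log 2) * Real.exp (-u) with hbd
  have hexp : IntegrableOn (fun u : ℝ ↦ Real.exp (-u)) (Set.Ioi 0) := integrableOn_exp_neg_Ioi 0
  have hbdi : IntegrableOn bd (Set.Ioi 0) :=
    integrableOn_abs_log_mul_exp_neg.add (hexp.const_mul _)
  have hΦm : ∀ s, AEStronglyMeasurable (Φ s) (volume.restrict (Set.Ioi 0)) := fun s ↦ by
    have : Measurable (Φ s) := by
      have := hAm.comp (Real.measurable_exp.comp (measurable_id.div_const s))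
      exact (this.add_const _).mul (by fun_prop)
    exact this.aestronglyMeasurable
  have hΦb : ∀ s, 0 < s → s < 1 → ∀ᵐ u ∂(volume.restrict (Set.Ioi (0 : ℝ))),
      ‖Φ s u‖ ≤ bd u := by
    intro s hs hs1
    refine (ae_restrict_iff' measurableSet_Ioi).2 (ae_of_all _ fun u hu ↦ ?_)
    have hu : 0 < u := hu
    simp only [hΦ, hbd]
    rw [norm_mul, Real.norm_eq_abs, Real.norm_of_nonneg (Real.exp_pos _).le, ← add_mul]
    refine mul_le_mul_of_nonneg_right ?_ (Real.exp_pos _).le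
    have hc : 0 ≤ |c| + K / Real.log 2 := by positivity
    rcases le_or_gt (s * Real.log 2) u with hsu | hsu
    · have a1 := hAexp s u hs hsu
      have a2 : K * s / u ≤ K / Real.log 2 := by
        rw [div_le_div_iff₀ hu hl2, mul_assoc]
        exact mul_le_mul_of_nonneg_left hsu hK0
      have a3 := abs_sub_abs_le_abs_sub (A (Real.exp (u / s)) + Real.log s) (Real.log u + c)
      have a4 := abs_add_le (Real.log u) c
      linarith
    · rw [hA0 s u hs hsu, zero_add]
      have a1 := Real.log_le_log hu (hsu.le.trans (mul_le_of_le_one_right hs.le hl2'.le))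
      have a2 := Real.log_neg hs hs1
      rw [abs_of_neg a2, abs_of_neg (a1.trans_lt a2)]
      linarith
  have hlim : Tendsto (fun s ↦ ∫ u in Set.Ioi (0 : ℝ), Φ s u) (𝓝[>] 0)
      (𝓝 (∫ u in Set.Ioi (0 : ℝ), (Real.log u + c) * Real.exp (-u))) := by
    refine tendsto_integral_filter_of_dominated_convergence bd (.of_forall hΦm) ?_ hbdi ?_
    · filter_upwards [Ioo_mem_nhdsGT (zero_lt_one' ℝ)] with s hs using hΦb s hs.1 hs.2
    · refine (ae_restrict_iff' measurableSet_Ioi).2 (ae_of_all _ fun u hu ↦ ?_)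
      have hu : 0 < u := hu
      refine Tendsto.mul_const _ (tendsto_iff_norm_sub_tendsto_zero.2 ?_)
      have hz : Tendsto (fun s : ℝ ↦ K * s / u) (𝓝[>] 0) (𝓝 0) := by
        have : Tendsto (fun s : ℝ ↦ K * s / u) (𝓝 0) (𝓝 (K * 0 / u)) :=
          Continuous.tendsto (by fun_prop) 0
        simpa using this.mono_left nhdsWithin_le_nhds
      refine tendsto_of_tendsto_of_tendsto_of_le_of_le' tendsto_const_nhds hz
        (.of_forall fun _ ↦ norm_nonneg _) ?_
      filter_upwards [Ioo_mem_nhdsGT (div_pos hu hl2)] with s hs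
      exact hAexp s u hs.1 ((le_div_iff₀ hl2).1 hs.2.le)
  have hval : ∫ u in Set.Ioi (0 : ℝ), (Real.log u + c) * Real.exp (-u) =
      c - Real.eulerMascheroniConstant := by
    simp only [add_mul]
    rw [integral_add integrableOn_log_mul_exp_neg (hexp.const_mul c), integral_log_mul_exp_neg,
      integral_const_mul, integral_exp_neg_Ioi_zero]
    ring
  rw [hval] at hlim
  refine hlim.congr' ?_
  filter_upwards [Ioo_mem_nhdsGT (zero_lt_one' ℝ)] with s hs
  have hΦi : IntegrableOn (Φ s) (Set.Ioi 0) := hbdi.mono' (hΦm s) (hΦb s hs.1 hs.2)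
  rw [tsum_eulerLog_mul_rpow_eq_integral hs.1]
  have : ∀ u, A (Real.exp (u / s)) * Real.exp (-u) = Φ s u - Real.log s * Real.exp (-u) :=
    fun u ↦ by rw [hΦ]; ring
  change _ = (∫ u in Set.Ioi (0 : ℝ), A (Real.exp (u / s)) * Real.exp (-u)) + _
  simp only [this]
  rw [integral_sub hΦi (hexp.const_mul _), integral_const_mul, integral_exp_neg_Ioi_zero]
  ring

/-- The logarithm of the Euler factor at `n` of `ζ` at `1 + s` if `n` is prime, and `0`
otherwise. -/
noncomputable def eulerLogShift (s : ℝ) (n : ℕ) : ℝ :=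
  if n.Prime then -Real.log (1 - ((n : ℝ) ^ (1 + s))⁻¹) else 0

lemma exp_tsum_eulerLogShift {s : ℝ} (hs : 0 < s) :
    ((Real.exp (∑' n : ℕ, eulerLogShift s n) : ℝ) : ℂ) = riemannZeta (1 + s : ℝ) := by
  rw [← riemannZeta_eulerProduct_exp_log (by simpa using hs), Complex.ofReal_exp,
    Complex.ofReal_tsum]
  congr 1
  refine Eq.trans ?_ (tsum_subtype {p : ℕ | p.Prime}
    (fun p : ℕ ↦ -Complex.log (1 - (p : ℂ) ^ (-((1 + s : ℝ) : ℂ))))).symm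
  refine tsum_congr fun n ↦ ?_
  unfold eulerLogShift
  split_ifs with h
  · rw [Set.indicator_of_mem (show n ∈ {p : ℕ | p.Prime} from h)]
    have h1 : (1 : ℝ) < n := by exact_mod_cast h.one_lt
    have h2 : (1 : ℝ) < (n : ℝ) ^ (1 + s) := Real.one_lt_rpow h1 (by linarith)
    rw [Complex.ofReal_neg, Complex.ofReal_log (sub_nonneg.2 (inv_lt_one_of_one_lt₀ h2).le),
      Complex.cpow_neg]
    push_cast
    rw [Complex.ofReal_cpow (by linarith)]
    push_cast
    rfl
  · rw [Set.indicator_of_notMem (show n ∉ {p : ℕ | p.Prime} from h)]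
    simp

lemma tendsto_tsum_eulerLogShift_add_log :
    Tendsto (fun s : ℝ ↦ ∑' n : ℕ, eulerLogShift s n + Real.log s) (𝓝[>] 0) (𝓝 0) := by
  have h1 : Tendsto (fun s : ℝ ↦ ((1 + s : ℝ) : ℂ)) (𝓝[>] 0) (𝓝[≠] 1) := by
    refine tendsto_nhdsWithin_iff.2 ⟨?_, ?_⟩
    · have : Tendsto (fun s : ℝ ↦ ((1 + s : ℝ) : ℂ)) (𝓝 0) (𝓝 ((1 + 0 : ℝ) : ℂ)) :=
        Continuous.tendsto (by fun_prop) 0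
      simpa using this.mono_left nhdsWithin_le_nhds
    · filter_upwards [self_mem_nhdsWithin] with s hs
      have : s ≠ 0 := ne_of_gt hs
      simp [this]
  have h2 := (Complex.continuous_re.tendsto _).comp (riemannZeta_residue_one.comp h1)
  have h3 : Tendsto (fun s : ℝ ↦ Real.exp (∑' n : ℕ, eulerLogShift s n) * s) (𝓝[>] 0) (𝓝 1) := by
    refine h2.congr' ?_
    filter_upwards [self_mem_nhdsWithin] with s hs
    simp only [Function.comp_apply]
    rw [← exp_tsum_eulerLogShift hs, ← Complex.ofReal_one, ← Complex.ofReal_sub,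
      ← Complex.ofReal_mul, Complex.ofReal_re]
    ring
  have h4 := h3.log one_ne_zero
  rw [Real.log_one] at h4
  refine h4.congr' ?_
  filter_upwards [self_mem_nhdsWithin] with s hs
  rw [Real.log_mul (Real.exp_pos _).ne' (ne_of_gt hs), Real.log_exp]

lemma abs_eulerLog_mul_rpow_sub_eulerLogShift_le {s : ℝ} (hs : 0 ≤ s) (n : ℕ) :
    |eulerLog n * (n : ℝ) ^ (-s) - eulerLogShift s n| ≤ 2 * (n : ℝ) ^ (-2 : ℝ) := by
  unfold eulerLog eulerLogShift
  split_ifs with h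
  · have h2 : (2 : ℝ) ≤ n := by exact_mod_cast h.two_le
    have h0 : (0 : ℝ) < n := by linarith
    set N : ℝ := (n : ℝ) ^ (1 + s) with hN
    set q : ℝ := (n : ℝ) ^ (-s) with hq
    have hq0 : 0 ≤ q := by positivity
    have hq1 : q ≤ 1 := Real.rpow_le_one_of_one_le_of_nonpos (by linarith) (by linarith)
    have hNn : (n : ℝ) ≤ N := by
      simpa using Real.rpow_le_rpow_of_exponent_le (by linarith : (1 : ℝ) ≤ n)
        (by linarith : 1 ≤ 1 + s)
    have hqN : q * (n : ℝ)⁻¹ = N⁻¹ := by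
      rw [hq, hN, ← Real.rpow_neg_one, ← Real.rpow_add h0, ← Real.rpow_neg h0.le]
      ring_nf
    have key : ∀ x : ℝ, (n : ℝ) ≤ x → (x - 1)⁻¹ - x⁻¹ ≤ 2 * (n : ℝ) ^ (-2 : ℝ) := by
      intro x hx
      rw [Real.rpow_neg h0.le, Real.rpow_two, inv_sub_inv (by linarith) (by linarith),
        ← div_eq_mul_inv, div_le_div_iff₀ (by nlinarith) (by positivity)]
      nlinarith
    have a1 := inv_le_neg_log_one_sub_inv (by linarith : 1 < (n : ℝ))
    have a2 := neg_log_one_sub_inv_le (by linarith : 1 < (n : ℝ))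
    have b1 := inv_le_neg_log_one_sub_inv (by linarith : 1 < N)
    have b2 := neg_log_one_sub_inv_le (by linarith : 1 < N)
    have k1 := key _ le_rfl
    have k2 := key N hNn
    have c1 : 0 ≤ (-Real.log (1 - (n : ℝ)⁻¹) - (n : ℝ)⁻¹) * q :=
      mul_nonneg (by linarith) hq0
    have c2 : (-Real.log (1 - (n : ℝ)⁻¹) - (n : ℝ)⁻¹) * q ≤
      -Real.log (1 - (n : ℝ)⁻¹) - (n : ℝ)⁻¹ := mul_le_of_le_one_right (by linarith) hq1
    rw [abs_le]
    constructor <;> linarith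
  · simp only [zero_mul, sub_zero, abs_zero]; positivity

lemma tendsto_tsum_eulerLog_add_log_zero :
    Tendsto (fun s : ℝ ↦ ∑' n : ℕ, eulerLog n * (n : ℝ) ^ (-s) + Real.log s) (𝓝[>] 0) (𝓝 0) := by
  have hsum : Summable fun n : ℕ ↦ 2 * (n : ℝ) ^ (-2 : ℝ) :=
    (Real.summable_nat_rpow.2 (by norm_num)).mul_left 2
  have h1 : Tendsto (fun s : ℝ ↦ ∑' n : ℕ, (eulerLog n * (n : ℝ) ^ (-s) - eulerLogShift s n))
      (𝓝[>] 0) (𝓝 (∑' _ : ℕ, (0 : ℝ))) := by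
    refine tendsto_tsum_of_dominated_convergence hsum (fun n ↦ ?_) ?_
    · refine Tendsto.mono_left ?_ nhdsWithin_le_nhds
      unfold eulerLog eulerLogShift
      split_ifs with h
      · have h1 : (1 : ℝ) < n := by exact_mod_cast h.one_lt
        have h3 : (1 : ℝ) - ((n : ℝ) ^ (1 + (0 : ℝ)))⁻¹ ≠ 0 := by
          rw [add_zero, Real.rpow_one]
          exact (sub_pos.2 (inv_lt_one_of_one_lt₀ h1)).ne'
        have : ContinuousAt (fun s : ℝ ↦ -Real.log (1 - (n : ℝ)⁻¹) * (n : ℝ) ^ (-s) -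
            -Real.log (1 - ((n : ℝ) ^ (1 + s))⁻¹)) 0 := by
          have hn : (n : ℝ) ≠ 0 := by linarith
          have e1 : ContinuousAt (fun s : ℝ ↦ (n : ℝ) ^ (-s)) 0 :=
            ContinuousAt.rpow continuousAt_const continuous_neg.continuousAt (Or.inl hn)
          have e2 : ContinuousAt (fun s : ℝ ↦ (n : ℝ) ^ (1 + s)) 0 :=
            ContinuousAt.rpow continuousAt_const (continuousAt_const.add continuousAt_id)
              (Or.inl hn)
          exact (continuousAt_const.mul e1).sub
            ((continuousAt_const.sub (e2.inv₀ (by positivity))).log h3).neg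
        convert this.tendsto using 2
        simp
      · simp
    · filter_upwards [self_mem_nhdsWithin] with s hs n
      exact abs_eulerLog_mul_rpow_sub_eulerLogShift_le (le_of_lt hs) n
  rw [tsum_zero] at h1
  have h2 := h1.add tendsto_tsum_eulerLogShift_add_log
  rw [add_zero] at h2
  refine h2.congr' ?_
  filter_upwards [self_mem_nhdsWithin] with s hs
  have hs0 : 0 < s := hs
  have e1 := summable_eulerLog_mul_rpow hs0
  have e2 : Summable fun n ↦ eulerLog n * (n : ℝ) ^ (-s) - eulerLogShift s n :=
    hsum.of_norm_bounded fun n ↦ abs_eulerLog_mul_rpow_sub_eulerLogShift_le hs0.le n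
  have e3 : Summable (eulerLogShift s) := by simpa using e1.sub e2
  rw [e1.tsum_sub e3]
  ring

/-- The third theorem of Mertens, in logarithmic form. -/
lemma exists_abs_sum_eulerLog_sub_log_log_sub_eulerMascheroniConstant_le :
    ∃ K : ℝ, ∀ x : ℝ, 2 ≤ x → |∑ k ∈ range (⌊x⌋₊ + 1), eulerLog k - Real.log (Real.log x) -
      Real.eulerMascheroniConstant| ≤ K / Real.log x := by
  obtain ⟨c, K, h⟩ := exists_abs_sum_eulerLog_sub_le
  have hc := tendsto_nhds_unique (tendsto_tsum_eulerLog_add_log h)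
    tendsto_tsum_eulerLog_add_log_zero
  rw [sub_eq_zero] at hc
  exact ⟨K, hc ▸ h⟩

lemma one_sub_prod_le_sum {ι : Type*} (s : Finset ι) (f : ι → ℝ) (h0 : ∀ i ∈ s, 0 ≤ f i)
    (h1 : ∀ i ∈ s, f i ≤ 1) : 1 - ∏ i ∈ s, f i ≤ ∑ i ∈ s, (1 - f i) := by
  classical
  induction s using Finset.induction_on with
  | empty => simp
  | insert a s ha ih =>
    rw [prod_insert ha, sum_insert ha]
    have ih := ih (fun i hi ↦ h0 i (mem_insert_of_mem hi)) (fun i hi ↦ h1 i (mem_insert_of_mem hi))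
    have a0 := h0 a (mem_insert_self _ _)
    have a1 := h1 a (mem_insert_self _ _)
    have p1 : ∏ i ∈ s, f i ≤ 1 := prod_le_one (fun i hi ↦ h0 i (mem_insert_of_mem hi))
      (fun i hi ↦ h1 i (mem_insert_of_mem hi))
    nlinarith

/-- Closed form of `(1 - z) ∑ (1 - ν / b) z ^ ν`. -/
lemma sum_one_sub_div_mul_pow_mul_one_sub {b : ℕ} (hb : 1 ≤ b) (z : ℝ) :
    (∑ ν ∈ range b, (1 - (ν : ℝ) / b) * z ^ ν) * (1 - z) =
      1 - (∑ ν ∈ range b, z ^ (ν + 1)) / b := by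
  have key : ∀ m : ℕ, (∑ ν ∈ range m, ((b : ℝ) - ν) * z ^ ν) * (1 - z) =
      b - (b - m) * z ^ m - ∑ ν ∈ range m, z ^ (ν + 1) := by
    intro m
    induction m with
    | zero => simp
    | succ m ih =>
      rw [sum_range_succ, sum_range_succ, add_mul, ih]
      push_cast
      ring
  have hb0 : (b : ℝ) ≠ 0 := by positivity
  have h1 : ∀ ν ∈ range b, (1 - (ν : ℝ) / b) * z ^ ν = (b : ℝ)⁻¹ * (((b : ℝ) - ν) * z ^ ν) := by
    intro ν _
    field_simp
  rw [sum_congr rfl h1, ← mul_sum, mul_assoc, key b]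
  field_simp
  ring

lemma sum_pow_succ_le {z : ℝ} (h0 : 0 ≤ z) (h1 : z < 1) (b : ℕ) :
    ∑ ν ∈ range b, z ^ (ν + 1) ≤ z / (1 - z) := by
  simp only [pow_succ']
  rw [← mul_sum, div_eq_mul_inv, ← tsum_geometric_of_lt_one h0 h1]
  exact mul_le_mul_of_nonneg_left ((summable_geometric_of_lt_one h0 h1).sum_le_tsum _
    fun _ _ ↦ by positivity) h0

lemma truncated_factor_bounds {p b : ℕ} (hp : p.Prime) (hb : 1 ≤ b) :
    0 ≤ (∑ ν ∈ range b, (1 - (ν : ℝ) / b) / (p : ℝ) ^ ν) * (1 - (p : ℝ)⁻¹) ∧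
    (∑ ν ∈ range b, (1 - (ν : ℝ) / b) / (p : ℝ) ^ ν) * (1 - (p : ℝ)⁻¹) ≤ 1 ∧
    1 - (∑ ν ∈ range b, (1 - (ν : ℝ) / b) / (p : ℝ) ^ ν) * (1 - (p : ℝ)⁻¹) ≤
      2 / b * eulerLog p := by
  have h2 : (2 : ℝ) ≤ p := by exact_mod_cast hp.two_le
  have hb0 : (0 : ℝ) < b := by exact_mod_cast hb
  have hz0 : (0 : ℝ) ≤ (p : ℝ)⁻¹ := by positivity
  have hz1 : (p : ℝ)⁻¹ < 1 := inv_lt_one_of_one_lt₀ (by linarith)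
  have hz2 : (p : ℝ)⁻¹ ≤ 1 / 2 := by
    rw [one_div]; exact inv_anti₀ (by norm_num) h2
  have e : ∀ ν ∈ range b, (1 - (ν : ℝ) / b) / (p : ℝ) ^ ν = (1 - (ν : ℝ) / b) * (p : ℝ)⁻¹ ^ ν :=
    fun ν _ ↦ by rw [inv_pow, div_eq_mul_inv]
  rw [sum_congr rfl e]
  refine ⟨mul_nonneg (sum_nonneg fun ν hν ↦ mul_nonneg ?_ (by positivity)) (by linarith), ?_, ?_⟩
  · rw [sub_nonneg, div_le_one hb0]
    exact_mod_cast (mem_range.1 hν).le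
  · rw [sum_one_sub_div_mul_pow_mul_one_sub hb, sub_le_self_iff]
    positivity
  · rw [sum_one_sub_div_mul_pow_mul_one_sub hb, sub_sub_cancel, div_mul_eq_mul_div]
    refine div_le_div_of_nonneg_right ?_ hb0.le
    have h3 : (p : ℝ)⁻¹ ≤ eulerLog p := by
      rw [eulerLog, if_pos hp]
      exact inv_le_neg_log_one_sub_inv (by linarith)
    refine (sum_pow_succ_le hz0 hz1 b).trans ?_
    rw [div_le_iff₀ (by linarith)]
    nlinarith

lemma exp_sum_eulerLog (n : ℕ) :
    Real.exp (∑ k ∈ range n, eulerLog k) = ∏ p ∈ (range n).filter Nat.Prime, (1 - (p : ℝ)⁻¹)⁻¹ := by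
  unfold eulerLog
  rw [← sum_filter, Real.exp_sum]
  refine prod_congr rfl fun p hp ↦ ?_
  have h1 : (1 : ℝ) < p := by exact_mod_cast (mem_filter.1 hp).2.one_lt
  rw [Real.exp_neg, Real.exp_log (sub_pos.2 (inv_lt_one_of_one_lt₀ h1))]

lemma abs_prod_truncated_sub_exp_sum_eulerLog_le (n : ℕ) {b : ℕ} (hb : 1 ≤ b) :
    |(∏ p ∈ (range n).filter Nat.Prime, ∑ ν ∈ range b, (1 - (ν : ℝ) / b) / (p : ℝ) ^ ν) -
      Real.exp (∑ k ∈ range n, eulerLog k)| ≤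
    Real.exp (∑ k ∈ range n, eulerLog k) * (2 / b * ∑ k ∈ range n, eulerLog k) := by
  set r : ℕ → ℝ := fun p ↦
    (∑ ν ∈ range b, (1 - (ν : ℝ) / b) / (p : ℝ) ^ ν) * (1 - (p : ℝ)⁻¹) with hr
  have hP : ∏ p ∈ (range n).filter Nat.Prime, ∑ ν ∈ range b, (1 - (ν : ℝ) / b) / (p : ℝ) ^ ν =
      Real.exp (∑ k ∈ range n, eulerLog k) * ∏ p ∈ (range n).filter Nat.Prime, r p := by
    rw [exp_sum_eulerLog, ← prod_mul_distrib]
    refine prod_congr rfl fun p hp ↦ ?_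
    have h1 : (1 : ℝ) < p := by exact_mod_cast (mem_filter.1 hp).2.one_lt
    have h2 : 1 - (p : ℝ)⁻¹ ≠ 0 := (sub_pos.2 (inv_lt_one_of_one_lt₀ h1)).ne'
    rw [hr, mul_comm, mul_assoc, mul_inv_cancel₀ h2, mul_one]
  have hb' := fun (p : ℕ) (hp : p ∈ (range n).filter Nat.Prime) ↦
    truncated_factor_bounds (mem_filter.1 hp).2 hb
  have h1 : ∏ p ∈ (range n).filter Nat.Prime, r p ≤ 1 :=
    prod_le_one (fun p hp ↦ (hb' p hp).1) (fun p hp ↦ (hb' p hp).2.1)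
  have h2 := one_sub_prod_le_sum ((range n).filter Nat.Prime) r (fun p hp ↦ (hb' p hp).1)
    (fun p hp ↦ (hb' p hp).2.1)
  have h3 : ∑ p ∈ (range n).filter Nat.Prime, (1 - r p) ≤ 2 / b * ∑ k ∈ range n, eulerLog k := by
    rw [mul_sum]
    exact (sum_le_sum fun p hp ↦ (hb' p hp).2.2).trans
      (sum_le_sum_of_subset_of_nonneg (filter_subset _ _)
        fun k _ _ ↦ mul_nonneg (by positivity) (eulerLog_nonneg k))
  rw [hP, ← mul_sub_one, abs_mul, abs_of_pos (Real.exp_pos _), abs_sub_comm,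
    abs_of_nonneg (sub_nonneg.2 h1)]
  exact mul_le_mul_of_nonneg_left (h2.trans h3) (Real.exp_pos _).le

/-- asymptotic formula for `∏_{p ≤ x} ∑_{ν=0}^{b-1} (1 - ν/b) p^{-ν}`. -/
theorem euler_product_asymptotic :
    ∃ C : ℝ, 0 < C ∧ ∀ x : ℝ, 3 ≤ x → ∀ b : ℕ, 1 ≤ b →
      |(∏ p ∈ (Finset.range (⌊x⌋₊ + 1)).filter Nat.Prime,
            ∑ ν ∈ Finset.range b, (1 - (ν : ℝ) / (b : ℝ)) / (p : ℝ) ^ ν)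
          - Real.exp Real.eulerMascheroniConstant * Real.log x|
        ≤ C * (Real.log (Real.log x) / (b : ℝ) + 1 / Real.log x) *
            (Real.exp Real.eulerMascheroniConstant * Real.log x) := by
  obtain ⟨K, hK⟩ := exists_abs_sum_eulerLog_sub_log_log_sub_eulerMascheroniConstant_le
  have hK0 : 0 ≤ K := by
    have hl2 : 0 < Real.log 2 := Real.log_pos (by norm_num)
    have := (div_nonneg_iff.1 ((abs_nonneg _).trans (hK 2 le_rfl))).resolve_right
      (by intro h; linarith [h.2])
    exact this.1
  set γ := Real.eulerMascheroniConstant with hγ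
  have hl3 : 1 < Real.log 3 := by
    rw [Real.lt_log_iff_exp_lt (by norm_num)]
    exact Real.exp_one_lt_d9.trans (by norm_num)
  set δ := Real.log (Real.log 3) with hδ
  have hδ0 : 0 < δ := Real.log_pos hl3
  set C₁ : ℝ := K * Real.exp K with hC₁
  set C₂ : ℝ := Real.exp K * (2 * (1 + (|γ| + K) / δ)) with hC₂
  have hC₁0 : 0 ≤ C₁ := by positivity
  have hC₂0 : 0 < C₂ := by positivity
  refine ⟨C₁ + C₂, by positivity, fun x hx b hb ↦ ?_⟩
  have hb0 : (0 : ℝ) < b := by exact_mod_cast hb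
  set L := Real.log x with hL
  have hL3 : Real.log 3 ≤ L := Real.log_le_log (by norm_num) hx
  have hL1 : 1 < L := hl3.trans_le hL3
  have hLL : δ ≤ Real.log L := Real.log_le_log (by linarith) hL3
  have h1 := hK x (by linarith)
  set B := ∑ k ∈ range (⌊x⌋₊ + 1), eulerLog k with hB
  set E := B - Real.log L - γ with hE
  have hEK : |E| ≤ K := h1.trans (div_le_self hK0 hL1.le)
  have hexpB : Real.exp B = Real.exp γ * L * Real.exp E := by
    have hBE : B = γ + Real.log L + E := by rw [hE]; ring
    rw [hBE, Real.exp_add, Real.exp_add, Real.exp_log (by linarith : 0 < L)]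
  have hexpE : |Real.exp E - 1| ≤ C₁ / L := by
    have a1 : |Real.exp E - 1| ≤ |E| * Real.exp |E| := by
      have b1 := Real.add_one_le_exp E
      have b2 := Real.add_one_le_exp (-E)
      have b3 : Real.exp E * Real.exp (-E) = 1 := by rw [← Real.exp_add]; simp
      have b4 := Real.exp_pos E
      rcases le_total 0 E with h | h
      · rw [abs_of_nonneg h, abs_of_nonneg (by linarith)]
        nlinarith
      · rw [abs_of_nonpos h, abs_of_nonpos (by linarith [Real.exp_le_one_iff.2 h])]
        nlinarith
    calc _ ≤ |E| * Real.exp |E| := a1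
      _ ≤ K / L * Real.exp K := mul_le_mul h1 (Real.exp_le_exp.2 hEK) (Real.exp_pos _).le
          (by positivity)
      _ = _ := by rw [hC₁]; ring
  have hBle : B ≤ (1 + (|γ| + K) / δ) * Real.log L := by
    have a1 : |γ| + K ≤ (|γ| + K) / δ * Real.log L := by
      rw [div_mul_eq_mul_div, le_div_iff₀ hδ0]
      exact mul_le_mul_of_nonneg_left hLL (by positivity)
    have a2 := (abs_le.1 hEK).2
    have a3 := le_abs_self γ
    rw [hE] at a2
    linarith
  have hM : 0 < Real.exp γ * L := by positivity
  have h2 := abs_prod_truncated_sub_exp_sum_eulerLog_le (⌊x⌋₊ + 1) hb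
  rw [← hB] at h2
  have h3 : Real.exp B * (2 / b * B) ≤ C₂ * (Real.log L / b) * (Real.exp γ * L) := by
    have a1 : Real.exp E ≤ Real.exp K := Real.exp_le_exp.2 ((le_abs_self E).trans hEK)
    have a2 : 2 / b * B ≤ 2 / b * ((1 + (|γ| + K) / δ) * Real.log L) :=
      mul_le_mul_of_nonneg_left hBle (by positivity)
    have hlogL : 0 ≤ Real.log L := hδ0.le.trans hLL
    calc _ ≤ Real.exp B * (2 / b * ((1 + (|γ| + K) / δ) * Real.log L)) :=
          mul_le_mul_of_nonneg_left a2 (Real.exp_pos _).le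
      _ ≤ (Real.exp γ * L * Real.exp K) * (2 / b * ((1 + (|γ| + K) / δ) * Real.log L)) := by
          rw [hexpB]
          exact mul_le_mul_of_nonneg_right (mul_le_mul_of_nonneg_left a1 hM.le) (by positivity)
      _ = _ := by rw [hC₂]; ring
  have h4 : |Real.exp B - Real.exp γ * L| ≤ C₁ * (1 / L) * (Real.exp γ * L) := by
    rw [hexpB, ← mul_sub_one, abs_mul, abs_of_pos hM, mul_comm, mul_one_div]
    exact mul_le_mul_of_nonneg_right hexpE hM.le
  refine (abs_sub_le _ (Real.exp B) _).trans ?_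
  have h5 : 0 ≤ C₁ * (Real.log L / b) * (Real.exp γ * L) := by
    have := hδ0.le.trans hLL
    positivity
  have h6 : 0 ≤ C₂ * (1 / L) * (Real.exp γ * L) := by positivity
  calc _ ≤ C₂ * (Real.log L / b) * (Real.exp γ * L) + C₁ * (1 / L) * (Real.exp γ * L) :=
        add_le_add (h2.trans h3) h4
    _ ≤ _ := by linarith
end

section
/- Let x ≥ 2 be real, let b ≥ 1 and J ≥ 1 be integers, and let i be an integer with 0 ≤ i ≤ J. Then Σ_{k ∈ M_i} (1/k) · #{m ∈ M : k | m} = b^{π(x)} · ∏_{p ≤ x^{i/J}} Σ_{ν=0}^{b−1} (1 − ν/b) p^{−ν}, where the product is over primes p ≤ x^{i/J}. -/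
open Finset Real

theorem sum_divisors_mul_of_coprime {R : Type*} [AddCommMonoid R] {m n : ℕ} (hmn : m.Coprime n)
    (f : ℕ → R) :
    ∑ d ∈ (m * n).divisors, f d = ∑ a ∈ m.divisors, ∑ c ∈ n.divisors, f (a * c) := by
  rw [Nat.divisors_mul, Finset.mul_def, Finset.sum_image hmn.mul_injOn_divisors,
    Finset.sum_product]

/-- The sum over divisors `k` of `n` of `1 / k` times the number of divisors of `m` that are
multiples of `k`. -/
noncomputable def recipMultipleSum (n m : ℕ) : ℝ :=
  ∑ k ∈ n.divisors, (1 / (k : ℝ)) * (m.divisors.filter (fun d => k ∣ d)).card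

theorem card_filter_dvd_divisors_mul {m₁ m₂ k₁ k₂ : ℕ} (hm : m₁.Coprime m₂)
    (hk₁ : k₁ ∣ m₁) (hk₂ : k₂ ∣ m₂) :
    ((m₁ * m₂).divisors.filter (fun d => k₁ * k₂ ∣ d)).card =
      (m₁.divisors.filter (fun d => k₁ ∣ d)).card *
        (m₂.divisors.filter (fun d => k₂ ∣ d)).card := by
  simp only [Finset.card_filter]
  rw [sum_divisors_mul_of_coprime hm, Finset.sum_mul_sum]
  refine Finset.sum_congr rfl fun a ha => Finset.sum_congr rfl fun c hc => ?_
  have ha := Nat.dvd_of_mem_divisors ha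
  have hc := Nat.dvd_of_mem_divisors hc
  have key : k₁ * k₂ ∣ a * c ↔ k₁ ∣ a ∧ k₂ ∣ c := by
    refine ⟨fun h => ⟨?_, ?_⟩, fun h => mul_dvd_mul h.1 h.2⟩
    · exact (hm.of_dvd hk₁ hc).dvd_of_dvd_mul_right ((dvd_mul_right _ _).trans h)
    · exact (hm.symm.of_dvd hk₂ ha).dvd_of_dvd_mul_left ((dvd_mul_left _ _).trans h)
  simp only [key, ite_and]
  split_ifs <;> simp

theorem recipMultipleSum_mul {n₁ n₂ m₁ m₂ : ℕ} (hm : m₁.Coprime m₂) (h₁ : n₁ ∣ m₁)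
    (h₂ : n₂ ∣ m₂) :
    recipMultipleSum (n₁ * n₂) (m₁ * m₂) =
      recipMultipleSum n₁ m₁ * recipMultipleSum n₂ m₂ := by
  unfold recipMultipleSum
  rw [sum_divisors_mul_of_coprime (hm.of_dvd h₁ h₂), Finset.sum_mul_sum]
  refine Finset.sum_congr rfl fun a ha => Finset.sum_congr rfl fun c hc => ?_
  rw [card_filter_dvd_divisors_mul hm ((Nat.dvd_of_mem_divisors ha).trans h₁)
    ((Nat.dvd_of_mem_divisors hc).trans h₂)]
  push_cast
  rw [← one_div_mul_one_div]
  ring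

theorem recipMultipleSum_one_prime_pow {p b : ℕ} (hp : p.Prime) (hb : 1 ≤ b) :
    recipMultipleSum 1 (p ^ (b - 1)) = b := by
  simp [recipMultipleSum, Nat.divisors_prime_pow hp, Nat.cast_sub hb]

theorem recipMultipleSum_prime_pow_self {p b : ℕ} (hp : p.Prime) (hb : 1 ≤ b) :
    recipMultipleSum (p ^ (b - 1)) (p ^ (b - 1)) =
      b * ∑ ν ∈ Finset.range b, (1 - (ν : ℝ) / (b : ℝ)) / (p : ℝ) ^ ν := by
  have hb0 : (b : ℝ) ≠ 0 := by positivity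
  rw [recipMultipleSum, Nat.sum_divisors_prime_pow hp, Nat.sub_add_cancel hb, Finset.mul_sum]
  refine Finset.sum_congr rfl fun ν hν => ?_
  have hν : ν ≤ b := (Finset.mem_range.1 hν).le
  have hcard : ((p ^ (b - 1)).divisors.filter (fun d => p ^ ν ∣ d)).card = b - ν := by
    rw [Nat.divisors_prime_pow hp, Finset.filter_map, Finset.card_map, Nat.sub_add_cancel hb,
      ← Nat.card_Ico]
    congr 1
    ext j
    simp [Nat.pow_dvd_pow_iff_le_right hp.one_lt, and_comm]
  rw [hcard, Nat.cast_sub hν]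
  push_cast
  field_simp

theorem recipMultipleSum_prod_prime_pow {b : ℕ} (hb : 1 ≤ b) (t : Finset ℕ) :
    ∀ s ⊆ t, (∀ p ∈ t, p.Prime) →
      recipMultipleSum (∏ p ∈ s, p ^ (b - 1)) (∏ p ∈ t, p ^ (b - 1)) =
        (b : ℝ) ^ t.card *
          ∏ p ∈ s, ∑ ν ∈ Finset.range b, (1 - (ν : ℝ) / (b : ℝ)) / (p : ℝ) ^ ν := by
  induction t using Finset.induction_on with
  | empty =>
    intro s hs _
    simp [Finset.subset_empty.1 hs, recipMultipleSum]
  | insert q t hq ih =>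
    intro s hs ht
    have hqp : q.Prime := ht q (Finset.mem_insert_self q t)
    have htp : ∀ p ∈ t, p.Prime := fun p hp => ht p (Finset.mem_insert_of_mem hp)
    have hcop : (q ^ (b - 1)).Coprime (∏ p ∈ t, p ^ (b - 1)) :=
      Nat.Coprime.prod_right fun p hp => Nat.Coprime.pow _ _ <|
        (Nat.coprime_primes hqp (htp p hp)).2 fun h => hq (h ▸ hp)
    rw [Finset.prod_insert hq, Finset.card_insert_of_notMem hq, pow_succ]
    by_cases hqs : q ∈ s
    · have hsub : s.erase q ⊆ t := Finset.subset_insert_iff.1 hs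
      rw [← Finset.mul_prod_erase s _ hqs, ← Finset.mul_prod_erase s _ hqs,
        recipMultipleSum_mul hcop dvd_rfl (Finset.prod_dvd_prod_of_subset _ _ _ hsub),
        recipMultipleSum_prime_pow_self hqp hb, ih _ hsub htp]
      ring
    · have hsub : s ⊆ t := (Finset.subset_insert_iff_of_notMem hqs).1 hs
      rw [← one_mul (∏ p ∈ s, p ^ (b - 1)),
        recipMultipleSum_mul hcop (one_dvd _) (Finset.prod_dvd_prod_of_subset _ _ _ hsub),
        recipMultipleSum_one_prime_pow hqp hb, ih _ hsub htp]
      ring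

/-- exact evaluation of `Σ_{k ∈ M_i} (1/k) · #{m ∈ M : k ∣ m}`. -/
theorem sum_over_Mi_eval (x : ℝ) (hx : 2 ≤ x) (b J : ℕ) (hb : 1 ≤ b) (hJ : 1 ≤ J)
    (i : ℕ) (hi : i ≤ J) :
    ∑ k ∈ (resonatorProd (x ^ ((i : ℝ) / (J : ℝ))) b).divisors,
        (1 / (k : ℝ)) * ((resonatorProd x b).divisors.filter (fun m => k ∣ m)).card
      = (b : ℝ) ^ ((Finset.range (⌊x⌋₊ + 1)).filter Nat.Prime).card *
          ∏ p ∈ (Finset.range (⌊x ^ ((i : ℝ) / (J : ℝ))⌋₊ + 1)).filter Nat.Prime,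
            ∑ ν ∈ Finset.range b, (1 - (ν : ℝ) / (b : ℝ)) / (p : ℝ) ^ ν := by
  have hle : x ^ ((i : ℝ) / (J : ℝ)) ≤ x := by
    refine Real.rpow_le_self_of_one_le (by linarith) (div_le_one_of_le₀ ?_ (Nat.cast_nonneg J))
    exact_mod_cast hi
  refine recipMultipleSum_prod_prime_pow hb _ _ ?_ fun p hp => (Finset.mem_filter.1 hp).2
  have hfloor := Nat.floor_mono hle
  exact Finset.filter_subset_filter _ (Finset.range_mono (by lia))
end

section
/- Let x ≥ 3 be real and let b ≥ 1, J ≥ 1, ℓ ≥ 0 be integers. Then Σ_{m ∈ M} Σ_{k | m} (log k)^ℓ / k ≥ (log x)^ℓ · Σ_{j=1}^{J} ((j−1)/J)^ℓ · Σ_{k ∈ M_j \ M_{j−1}} (1/k) · #{m ∈ M : k | m}. -/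
open Finset Real

theorem resonatorProd_ne_zero (x : ℝ) (b : ℕ) : resonatorProd x b ≠ 0 :=
  Finset.prod_ne_zero_iff.2 fun _ hp => pow_ne_zero _ (Finset.mem_filter.1 hp).2.ne_zero

theorem filter_prime_range_floor_subset {y x : ℝ} (h : y ≤ x) :
    (Finset.range (⌊y⌋₊ + 1)).filter Nat.Prime ⊆ (Finset.range (⌊x⌋₊ + 1)).filter Nat.Prime :=
  Finset.filter_subset_filter _ (Finset.range_mono (Nat.succ_le_succ (Nat.floor_mono h)))

theorem resonatorProd_dvd_of_le {y x : ℝ} (h : y ≤ x) (b : ℕ) :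
    resonatorProd y b ∣ resonatorProd x b :=
  Finset.prod_dvd_prod_of_subset _ _ _ (filter_prime_range_floor_subset h)

theorem divisors_resonatorProd_subset {y x : ℝ} (h : y ≤ x) (b : ℕ) :
    (resonatorProd y b).divisors ⊆ (resonatorProd x b).divisors :=
  Nat.divisors_subset_of_dvd (resonatorProd_ne_zero x b) (resonatorProd_dvd_of_le h b)

/-- A divisor of `resonatorProd x b` not dividing `resonatorProd y b` is at least `y`,
since it has a prime factor exceeding `y`. -/
theorem le_of_dvd_resonatorProd_of_not_dvd {y x : ℝ} (hyx : y ≤ x) {b k : ℕ}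
    (hk : k ∣ resonatorProd x b) (hky : ¬ k ∣ resonatorProd y b) : y ≤ k := by
  by_contra! hlt
  refine hky (Nat.Coprime.dvd_of_dvd_mul_left ?_
    (hk.trans (Finset.prod_sdiff (filter_prime_range_floor_subset hyx)).symm.dvd))
  refine Nat.Coprime.prod_right fun p hp => Nat.Coprime.pow_right _ ?_
  obtain ⟨hpx, hpy⟩ := Finset.mem_sdiff.1 hp
  have hprime := (Finset.mem_filter.1 hpx).2
  refine ((hprime.coprime_iff_not_dvd).2 fun hpk => hpy ?_).symm
  have hk0 : 0 < k := Nat.pos_of_dvd_of_pos hk (Nat.pos_of_ne_zero (resonatorProd_ne_zero x b))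
  have hle : p ≤ ⌊y⌋₊ := (Nat.le_of_dvd hk0 hpk).trans (Nat.le_floor hlt.le)
  exact Finset.mem_filter.2 ⟨Finset.mem_range.2 (Nat.lt_succ_of_le hle), hprime⟩

theorem sum_Icc_one_sub_eq (S : ℝ → ℝ) (n : ℕ) :
    ∑ j ∈ Finset.Icc 1 n, (S j - S ((j : ℝ) - 1)) = S n - S 0 := by
  induction n with
  | zero => simp
  | succ n ih =>
    rw [Finset.sum_Icc_succ_top (by omega), ih]
    push_cast
    rw [add_sub_cancel_right]
    ring

theorem sum_divisors_sum_divisors_eq_s7 (n : ℕ) (g : ℕ → ℝ) :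
    ∑ m ∈ n.divisors, ∑ k ∈ m.divisors, g k =
      ∑ k ∈ n.divisors, g k * (n.divisors.filter (fun m => k ∣ m)).card := by
  rw [Finset.sum_comm' (t' := n.divisors) (s' := fun k => n.divisors.filter (fun m => k ∣ m))]
  · simp [mul_comm]
  · intro m k
    simp only [Nat.mem_divisors, Finset.mem_filter]
    exact ⟨fun ⟨⟨hm, hn⟩, hk, _⟩ => ⟨⟨⟨hm, hn⟩, hk⟩, hk.trans hm, hn⟩,
      fun ⟨⟨⟨hm, hn⟩, hk⟩, _⟩ => ⟨⟨hm, hn⟩, hk, ne_zero_of_dvd_ne_zero hn hm⟩⟩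

/-- lower bound for `S(x;ℓ)` by splitting `M` into the sets `M_j \ M_{j-1}`. -/
theorem weighted_sum_splitting_lower_bound (x : ℝ) (hx : 3 ≤ x) (b J ℓ : ℕ)
    (hb : 1 ≤ b) (hJ : 1 ≤ J) :
    ∑ m ∈ (resonatorProd x b).divisors, ∑ k ∈ m.divisors, (Real.log k) ^ ℓ / (k : ℝ)
      ≥ (Real.log x) ^ ℓ *
          ∑ j ∈ Finset.Icc 1 J, (((j : ℝ) - 1) / (J : ℝ)) ^ ℓ *
            ∑ k ∈ (resonatorProd (x ^ ((j : ℝ) / (J : ℝ))) b).divisors \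
                (resonatorProd (x ^ (((j : ℝ) - 1) / (J : ℝ))) b).divisors,
              (1 / (k : ℝ)) *
                ((resonatorProd x b).divisors.filter (fun m => k ∣ m)).card := by
  rw [sum_divisors_sum_divisors_eq_s7, ge_iff_le]
  have hJ0 : (0 : ℝ) < J := by exact_mod_cast hJ
  have hx0 : 0 < x := by linarith
  have hlogx : 0 ≤ Real.log x := Real.log_nonneg (by linarith)
  set c : ℕ → ℝ := fun k => ((resonatorProd x b).divisors.filter (fun m => k ∣ m)).card
  set f : ℕ → ℝ := fun k => (Real.log k) ^ ℓ / (k : ℝ) * c k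
  have hf : ∀ k, 0 ≤ f k := fun k => by
    have := Real.log_natCast_nonneg k
    positivity
  set S : ℝ → ℝ := fun t => ∑ k ∈ (resonatorProd (x ^ (t / (J : ℝ))) b).divisors, f k
  have hS : ∀ t, 0 ≤ S t := fun t => Finset.sum_nonneg fun k _ => hf k
  have hblock : ∀ j ∈ Finset.Icc 1 J, Real.log x ^ ℓ * ((((j : ℝ) - 1) / (J : ℝ)) ^ ℓ *
      ∑ k ∈ (resonatorProd (x ^ ((j : ℝ) / (J : ℝ))) b).divisors \
        (resonatorProd (x ^ (((j : ℝ) - 1) / (J : ℝ))) b).divisors, (1 / (k : ℝ)) * c k)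
      ≤ S j - S ((j : ℝ) - 1) := by
    intro j hj
    have hj1 : (1 : ℝ) ≤ j := by exact_mod_cast (Finset.mem_Icc.1 hj).1
    have hpow : x ^ (((j : ℝ) - 1) / (J : ℝ)) ≤ x ^ ((j : ℝ) / (J : ℝ)) :=
      Real.rpow_le_rpow_of_exponent_le (by linarith) (by gcongr; linarith)
    rw [← Finset.sum_sdiff_eq_sub (divisors_resonatorProd_subset hpow b), ← mul_assoc,
      ← mul_pow, Finset.mul_sum]
    refine Finset.sum_le_sum fun k hk => ?_
    simp only [Finset.mem_sdiff, Nat.mem_divisors, resonatorProd_ne_zero, ne_eq,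
      not_false_eq_true, and_true] at hk
    have hle := le_of_dvd_resonatorProd_of_not_dvd hpow hk.1 hk.2
    have hlog := Real.log_le_log (Real.rpow_pos_of_pos hx0 _) hle
    rw [Real.log_rpow hx0, mul_comm] at hlog
    have hnn : 0 ≤ Real.log x * (((j : ℝ) - 1) / J) :=
      mul_nonneg hlogx (div_nonneg (by linarith) hJ0.le)
    calc _ = (Real.log x * (((j : ℝ) - 1) / J)) ^ ℓ / k * c k := by ring
      _ ≤ f k := by
        simp only [f]
        gcongr
  have hSJ : S J = ∑ k ∈ (resonatorProd x b).divisors, f k := by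
    simp only [S, div_self hJ0.ne', Real.rpow_one]
  rw [Finset.mul_sum, ← hSJ]
  refine (Finset.sum_le_sum hblock).trans ?_
  rw [sum_Icc_one_sub_eq]
  linarith [hS 0]
end
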